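/- Let d ≥ 1 and let G = ([n], E) be a minimally d-rigid graph whose vertices are labelled so that 1i ∈ E for all 2 ≤ i ≤ d. In the parametrised Laurent polynomial ring ℂ[a,c][y^±] with parameters a_{ij} (ij ∈ E, i < j) and c_{l,k} (l ∈ [d−1], k ∈ [d]) and Laurent variables y_{ij,k} (ij ∈ E, i < j, k ∈ [d]), with the convention y_{st,k} := −y_{ts,k} for s > t, let I_E be the ideal generated by f_{ij} := Σ_{k=1}^d y_{ij,k}² − a_{ij} for ij ∈ E, g_{i,l} := Σ_{k=1}^d c_{l,k} y_{1i,k} for i ∈ [d]\{1} and l ∈ [d+1−i], and h_{C,k} := Σ_{(s,t)∈C} y_{st,k} for each directed cycle C of G and k ∈ [d]. Then the generic root count ℓ_{I_E, ℂ(a,c)} equals 2^d · c_d(G). -/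

import Mathlib

open scoped BigOperators

set_option synthInstance.maxHeartbeats 1000000
set_option maxHeartbeats 1000000

noncomputable section

namespace PaperDefs

/-- Two complex realisations are congruent if they differ by a complex orthogonal
transformation followed by a translation. -/
def Congruent {n d : ℕ} (p q : Fin n → Fin d → ℂ) : Prop :=
  ∃ (A : Matrix (Fin d) (Fin d) ℂ) (x : Fin d → ℂ),
    A * A.transpose = 1 ∧ A.transpose * A = 1 ∧ ∀ i, p i = A.mulVec (q i) + x

/-- Two real realisations are congruent if they differ by an isometry of `ℝ^d`. -/
def RealCongruent {n d : ℕ} (p q : Fin n → Fin d → ℝ) : Prop :=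
  ∃ (A : Matrix (Fin d) (Fin d) ℝ) (x : Fin d → ℝ),
    A * A.transpose = 1 ∧ A.transpose * A = 1 ∧ ∀ i, p i = A.mulVec (q i) + x

/-- The complex rigidity map `f_{G,d}`, recording half the squared edge lengths. -/
def rigidityMap {n : ℕ} (G : SimpleGraph (Fin n)) (d : ℕ)
    (p : Fin n → Fin d → ℂ) : G.edgeSet → ℂ :=
  fun e => Sym2.lift ⟨fun i j => (2⁻¹ : ℂ) * ∑ k, (p i k - p j k) ^ 2,
    fun i j => by
      have h : ∀ k, (p i k - p j k) ^ 2 = (p j k - p i k) ^ 2 := fun k => by ring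
      simp only [h]⟩ (e : Sym2 (Fin n))

/-- A real framework `(G,p)` is rigid: every continuous edge-length-preserving motion
starting at `p` stays congruent to `p`. -/
def IsRigidFramework {n : ℕ} (G : SimpleGraph (Fin n)) (d : ℕ)
    (p : Fin n → Fin d → ℝ) : Prop :=
  ∀ q : ℝ → Fin n → Fin d → ℝ,
    ContinuousOn q (Set.Icc 0 1) → q 0 = p →
    (∀ t ∈ Set.Icc (0 : ℝ) 1, ∀ i j, G.Adj i j →
        ∑ k, (q t i k - q t j k) ^ 2 = ∑ k, (p i k - p j k) ^ 2) →
    ∀ t ∈ Set.Icc (0 : ℝ) 1, RealCongruent (q t) p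

/-- `G` is `d`-rigid: generic real realisations give rigid frameworks. -/
def IsRigidGraph {n : ℕ} (G : SimpleGraph (Fin n)) (d : ℕ) : Prop :=
  ∃ f : MvPolynomial (Fin n × Fin d) ℝ, f ≠ 0 ∧
    ∀ p : Fin n → Fin d → ℝ,
      MvPolynomial.eval (fun v => p v.1 v.2) f ≠ 0 → IsRigidFramework G d p

/-- `G` is minimally `d`-rigid. -/
def IsMinimallyRigidGraph {n : ℕ} (G : SimpleGraph (Fin n)) (d : ℕ) : Prop :=
  IsRigidGraph G d ∧ ∀ e ∈ G.edgeSet, ¬ IsRigidGraph (G.deleteEdges {e}) d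

/-- The set of congruence classes of a set of complex realisations. -/
def congClasses {n d : ℕ} (S : Set (Fin n → Fin d → ℂ)) :
    Set (Set (Fin n → Fin d → ℂ)) :=
  (fun q => {q' ∈ S | Congruent q q'}) '' S

/-- `c` is the `d`-realisation number of `G`: for generic complex `p` the fibre of the
rigidity map through `p` has exactly `c` congruence classes. -/
def IsRealisationNumber {n : ℕ} (G : SimpleGraph (Fin n)) (d : ℕ) (c : ℕ) : Prop :=
  0 < c ∧ ∃ f : MvPolynomial (Fin n × Fin d) ℂ, f ≠ 0 ∧
    ∀ p : Fin n → Fin d → ℂ,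
      MvPolynomial.eval (fun v => p v.1 v.2) f ≠ 0 →
        (congClasses {q | rigidityMap G d q = rigidityMap G d p}).ncard = c

/-- The Zariski closure of the image of the rigidity map `f_{G,d}`. -/
def rigidityImageClosure {n : ℕ} (G : SimpleGraph (Fin n)) (d : ℕ) :
    Set (G.edgeSet → ℂ) :=
  {lam | ∀ f : MvPolynomial G.edgeSet ℂ,
    (∀ p, MvPolynomial.eval (rigidityMap G d p) f = 0) → MvPolynomial.eval lam f = 0}

/-- The Laurent polynomial ring over `K` in variables indexed by `V`, realised as the
group algebra of the free abelian group on `V`. -/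
abbrev LaurentRing (K : Type*) [CommRing K] (V : Type*) : Type _ :=
  AddMonoidAlgebra K (V →₀ ℤ)

/-- The Laurent variable `x_v`. -/
def LX {K : Type*} [CommRing K] {V : Type*} (v : V) : LaurentRing K V :=
  AddMonoidAlgebra.single (Finsupp.single v 1) 1

/-- The inverse Laurent variable `x_v⁻¹`. -/
def LXinv {K : Type*} [CommRing K] {V : Type*} (v : V) : LaurentRing K V :=
  AddMonoidAlgebra.single (Finsupp.single v (-1)) 1

/-- The field of rational functions `ℂ(a)` in parameters indexed by `P`. -/
abbrev RatFuncField (P : Type*) : Type _ := FractionRing (MvPolynomial P ℂ)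

/-- The parameter `a_p` as an element of `ℂ(a)`. -/
def ratParam {P : Type*} (p : P) : RatFuncField P :=
  algebraMap (MvPolynomial P ℂ) (RatFuncField P) (MvPolynomial.X p)

/-- The signed Laurent variable `y_{st,k}` attached to a dart (directed edge) of `G`:
it is `y_{e,k}` if the dart is increasingly oriented and `-y_{e,k}` otherwise, where `e`
is the underlying undirected edge. -/
def ydir {n : ℕ} {G : SimpleGraph (Fin n)} (K : Type*) [CommRing K] {d : ℕ}
    (dd : G.Dart) (k : Fin d) : LaurentRing K (↥G.edgeSet × Fin d) :=
  if dd.toProd.1 < dd.toProd.2 then LX (⟨dd.edge, dd.edge_mem⟩, k)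
  else - LX (⟨dd.edge, dd.edge_mem⟩, k)

/-- The signed Laurent variable `y_{st}` attached to a dart of `G` (single-variable
version). -/
def ydirE {n : ℕ} {G : SimpleGraph (Fin n)} (K : Type*) [CommRing K]
    (dd : G.Dart) : LaurentRing K ↥G.edgeSet :=
  if dd.toProd.1 < dd.toProd.2 then LX ⟨dd.edge, dd.edge_mem⟩
  else - LX ⟨dd.edge, dd.edge_mem⟩

/-- The signed inverse Laurent variable `y_{st}⁻¹` attached to a dart of `G`. -/
def ydirEinv {n : ℕ} {G : SimpleGraph (Fin n)} (K : Type*) [CommRing K]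
    (dd : G.Dart) : LaurentRing K ↥G.edgeSet :=
  if dd.toProd.1 < dd.toProd.2 then LXinv ⟨dd.edge, dd.edge_mem⟩
  else - LXinv ⟨dd.edge, dd.edge_mem⟩

section
open scoped TensorProduct

theorem isIntegral_of_finite_values {K Ω B : Type*} [Field K] [Field Ω] [IsAlgClosed Ω]
    [Algebra K Ω] [CommRing B] [Algebra K B] [Algebra.FiniteType K B] (b : B)
    (hfin : (Set.range fun φ : B →ₐ[K] Ω => φ b).Finite) : IsIntegral K b := by
  classical
  set s := hfin.toFinset with hs
  let P : Polynomial Ω := ∏ z ∈ s, (Polynomial.X - Polynomial.C z)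
  have hP : P.Monic := Polynomial.monic_prod_of_monic _ _ fun z _ => Polynomial.monic_X_sub_C z
  set t : Ω ⊗[K] B := 1 ⊗ₜ b with ht
  have : IsJacobsonRing (Ω ⊗[K] B) := isJacobsonRing_of_finiteType (A := Ω)
  have hnil : IsNilpotent (Polynomial.aeval t P) := by
    rw [← mem_nilradical, nilradical, Ideal.radical_eq_jacobson, Ideal.jacobson, Submodule.mem_sInf]
    rintro m ⟨-, hm⟩
    let _ := Ideal.Quotient.field m
    have : Module.Finite Ω ((Ω ⊗[K] B) ⧸ m) := finite_of_finite_type_of_isJacobsonRing _ _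
    have hbij : Function.Bijective (algebraMap Ω ((Ω ⊗[K] B) ⧸ m)) :=
      IsAlgClosed.algebraMap_bijective_of_isIntegral
    let e : Ω ≃ₐ[Ω] ((Ω ⊗[K] B) ⧸ m) := AlgEquiv.ofBijective (Algebra.ofId _ _) hbij
    let ψ : (Ω ⊗[K] B) →ₐ[Ω] Ω := e.symm.toAlgHom.comp (Ideal.Quotient.mkₐ Ω m)
    let φ : B →ₐ[K] Ω := (ψ.restrictScalars K).comp Algebra.TensorProduct.includeRight
    have hφ : φ b = ψ t := rfl
    have hz : φ b ∈ s := by rw [hs, Set.Finite.mem_toFinset]; exact ⟨φ, rfl⟩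
    have h0 : ψ (Polynomial.aeval t P) = 0 := by
      rw [← Polynomial.aeval_algHom_apply, ← hφ]
      simp only [P, map_prod, map_sub, Polynomial.aeval_X, Polynomial.aeval_C]
      exact Finset.prod_eq_zero hz (sub_self _)
    have h1 : (Ideal.Quotient.mkₐ Ω m) (Polynomial.aeval t P) = 0 := by
      apply e.symm.injective
      rw [map_zero]; exact h0
    exact Ideal.Quotient.eq_zero_iff_mem.mp h1
  obtain ⟨N, hN⟩ := hnil
  by_contra hb
  have htr : Transcendental K b := fun h => hb h.isIntegral
  have hli : LinearIndependent K (fun i : ℕ => b ^ i) := by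
    rw [transcendental_iff_injective] at htr
    have := (Polynomial.basisMonomials K).linearIndependent.map'
      (Polynomial.aeval (R := K) b).toLinearMap
      (LinearMap.ker_eq_bot.mpr htr)
    have h2 : (fun i : ℕ => b ^ i) =
        (Polynomial.aeval (R := K) b).toLinearMap ∘ (Polynomial.basisMonomials K) := by
      ext i; simp
    rw [h2]; exact this
  have hli2 : LinearIndependent Ω (fun i : ℕ => t ^ i) := by
    have := Module.Flat.linearIndependent_one_tmul (S := Ω) hli
    simpa [ht] using this
  have hP2 : Polynomial.aeval t (P ^ N) = 0 := by rw [map_pow, hN]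
  have : P ^ N = 0 := by
    rw [Polynomial.aeval_eq_sum_range] at hP2
    have := linearIndependent_iff'.mp hli2 _ _ hP2
    ext i
    by_cases hi : i < (P ^ N).natDegree + 1
    · simpa using this i (Finset.mem_range.mpr hi)
    · rw [Polynomial.coeff_eq_zero_of_natDegree_lt (by omega)]; simp
  exact (hP.pow N).ne_zero this

end

section
open MvPolynomial

/-- The linear form with coefficient vector `w`. -/
def linForm {R V : Type*} [CommRing R] [Fintype V] : (V → R) →ₗ[R] MvPolynomial V R :=
  Fintype.linearCombination R (fun v => (X v : MvPolynomial V R))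

theorem linForm_apply {R V : Type*} [CommRing R] [Fintype V] (w : V → R) :
    linForm w = ∑ v, C (w v) * X v := by
  simp [linForm, Fintype.linearCombination_apply, MvPolynomial.smul_eq_C_mul]

theorem linForm_single {R V : Type*} [CommRing R] [Fintype V] [DecidableEq V] (v : V) :
    linForm (Pi.single v (1 : R)) = X v := by
  rw [linForm, Fintype.linearCombination_apply_single, one_smul]

theorem coeff_linForm {R V : Type*} [CommRing R] [Fintype V] (w : V → R) (v : V) :
    coeff (Finsupp.single v 1) (linForm w) = w v := by
  classical
  rw [linForm_apply, coeff_sum]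
  simp only [coeff_C_mul, coeff_X]
  rw [Finset.sum_eq_single v]
  · simp
  · intro b _ hb
    rw [if_neg, mul_zero]
    intro h
    exact hb (Finsupp.single_left_injective one_ne_zero h)
  · simp

theorem map_linForm {R S V : Type*} [CommRing R] [CommRing S] [Fintype V] (g : R →+* S)
    (w : V → R) : map g (linForm w) = linForm fun v => g (w v) := by
  simp [linForm_apply]


section
variable {R K F Ω V : Type*} [CommRing R] [Field K] [Algebra R K] [IsFractionRing R K]
  [Field F] [Field Ω] [Algebra K Ω] [Fintype V]

/-- Equations obtained by equating polynomials with independent parameters, together with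
linear forms. -/
def eqnSystem (i : F →+* K) (W : Submodule F (V → F)) (j₁ : R →+* MvPolynomial V F) :
    Set (MvPolynomial V K) :=
  (fun w => map i (linForm w)) '' (W : Set (V → F)) ∪
    Set.range fun r => map i (j₁ r) - C (algebraMap R K r)

theorem exists_linear_retraction (W : Submodule F (V → F)) :
    ∃ T : (V → F) →ₗ[F] (V → F), (∀ w ∈ W, T w = 0) ∧ ∀ w, w - T w ∈ W := by
  obtain ⟨s, hs⟩ := LinearMap.exists_rightInverse_of_surjective W.mkQ (Submodule.range_mkQ W)
  refine ⟨s.comp W.mkQ, fun w hw => ?_, fun w => ?_⟩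
  · simp only [LinearMap.comp_apply, (Submodule.mkQ_apply W w),
      (Submodule.Quotient.mk_eq_zero W).mpr hw, map_zero]
  · rw [← Submodule.Quotient.mk_eq_zero, ← Submodule.mkQ_apply, map_sub]
    have := LinearMap.congr_fun hs (W.mkQ w)
    simp only [LinearMap.comp_apply, LinearMap.id_apply] at this
    rw [sub_eq_zero]
    exact this.symm

/-- Substitution of linear forms. -/
def linSubst (T : (V → F) →ₗ[F] (V → F)) : MvPolynomial V F →ₐ[F] MvPolynomial V F :=
  letI := Classical.decEq V
  aeval fun v => linForm (T (Pi.single v 1))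

theorem linSubst_X [DecidableEq V] (T : (V → F) →ₗ[F] (V → F)) (v : V) :
    linSubst T (X v) = linForm (T (Pi.single v 1)) := by
  simp only [linSubst, aeval_X]
  congr!

theorem linSubst_linForm (T : (V → F) →ₗ[F] (V → F)) (w : V → F) :
    linSubst T (linForm w) = linForm (T w) := by
  classical
  have : ((linSubst T).toLinearMap.comp linForm) = linForm.comp T := by
    apply LinearMap.pi_ext'
    intro v
    ext
    simp [linForm_single, linSubst_X]
  exact LinearMap.congr_fun this w

theorem comp_linSubst {S : Type*} [CommRing S] (W : Submodule F (V → F))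
    (T : (V → F) →ₗ[F] (V → F)) (hT : ∀ w, w - T w ∈ W) (ε : MvPolynomial V F →+* S)
    (hε : ∀ w ∈ W, ε (linForm w) = 0) (p : MvPolynomial V F) : ε (linSubst T p) = ε p := by
  classical
  have : ε.comp (linSubst T).toRingHom = ε := by
    apply MvPolynomial.ringHom_ext
    · intro r
      simp only [RingHom.comp_apply, AlgHom.toRingHom_eq_coe, RingHom.coe_coe]
      rw [← algebraMap_eq, AlgHom.commutes]
    · intro v
      have := hε _ (hT (Pi.single v 1))
      rw [map_sub, map_sub, linForm_single, sub_eq_zero] at this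
      simpa [linSubst_X] using this.symm
  exact RingHom.congr_fun this p

theorem linSubst_comp_injective (i : F →+* K) (W : Submodule F (V → F))
    (j₁ : R →+* MvPolynomial V F) (η : V → Ω) (hη : ∀ g ∈ eqnSystem i W j₁, aeval η g = 0)
    (T : (V → F) →ₗ[F] (V → F)) (hT : ∀ w, w - T w ∈ W) :
    Function.Injective ((linSubst T).toRingHom.comp j₁) := by
  let ε : MvPolynomial V F →+* Ω := (aeval η).toRingHom.comp (map i)
  have hε : ∀ w ∈ W, ε (linForm w) = 0 := fun w hw => hη _ (Or.inl ⟨w, hw, rfl⟩)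
  have hεj : (ε.comp (linSubst T).toRingHom).comp j₁ = (algebraMap K Ω).comp (algebraMap R K) := by
    ext r
    have h1 := hη _ (Or.inr ⟨r, rfl⟩)
    have h2 := comp_linSubst W T hT ε hε (j₁ r)
    rw [map_sub, aeval_C, sub_eq_zero] at h1
    exact h2.trans h1
  have h1 : Function.Injective ((algebraMap K Ω).comp (algebraMap R K)) :=
    (algebraMap K Ω).injective.comp (IsFractionRing.injective R K)
  rw [← hεj] at h1
  exact Function.Injective.of_comp (f := ε) h1

theorem exists_ker_eq_span {L : Type*} [Field L] [Algebra (MvPolynomial V F) L]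
    [IsFractionRing (MvPolynomial V F) L] (i : F →+* K) (W : Submodule F (V → F))
    (j₁ : R →+* MvPolynomial V F)
    (hi : ∀ x, ∃ a b, b ≠ 0 ∧ i x * algebraMap R K b = algebraMap R K a ∧
      j₁ a = C x * j₁ b)
    (T : (V → F) →ₗ[F] (V → F)) (hT0 : ∀ w ∈ W, T w = 0) (hT : ∀ w, w - T w ∈ W)
    (hj : Function.Injective ((linSubst T).toRingHom.comp j₁)) :
    ∃ θ : MvPolynomial V K →+* L, RingHom.ker θ = Ideal.span (eqnSystem i W j₁) ∧
      ∀ v, θ (X v) = algebraMap (MvPolynomial V F) L (linSubst T (X v)) := by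
  set I := Ideal.span (eqnSystem i W j₁) with hI
  have hjQ : Function.Injective ((algebraMap (MvPolynomial V F) L).comp
      ((linSubst T).toRingHom.comp j₁)) :=
    (IsFractionRing.injective (MvPolynomial V F) L).comp hj
  let jK : K →+* L := IsFractionRing.lift hjQ
  have hjK : ∀ x, jK (algebraMap R K x) = algebraMap (MvPolynomial V F) L (linSubst T (j₁ x)) :=
    fun x => IsFractionRing.lift_algebraMap hjQ x
  let θ : MvPolynomial V K →+* L :=
    eval₂Hom jK fun v => algebraMap (MvPolynomial V F) L (linSubst T (X v))
  have hjKi : ∀ x, jK (i x) = algebraMap (MvPolynomial V F) L (C x) := by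
    intro x
    obtain ⟨a, b, hb, h1, h2⟩ := hi x
    have h3 := congrArg jK h1
    rw [map_mul, hjK, hjK, h2, map_mul, map_mul] at h3
    have hb' : algebraMap (MvPolynomial V F) L (linSubst T (j₁ b)) ≠ 0 := by
      rw [← hjK]
      intro h
      rw [map_eq_zero] at h
      exact hb (IsFractionRing.injective R K (by rw [h, map_zero]))
    have h4 := mul_right_cancel₀ hb' h3
    rw [h4, ← algebraMap_eq, AlgHom.commutes]
  have hθδ : ∀ p : MvPolynomial V F,
      θ (map i p) = algebraMap (MvPolynomial V F) L (linSubst T p) := by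
    intro p
    have : θ.comp (map i) = (algebraMap (MvPolynomial V F) L).comp (linSubst T).toRingHom := by
      apply MvPolynomial.ringHom_ext
      · intro r
        simp only [RingHom.comp_apply, map_C, θ, coe_eval₂Hom, eval₂_C, hjKi]
        simp only [AlgHom.toRingHom_eq_coe, RingHom.coe_coe]
        rw [← algebraMap_eq, AlgHom.commutes]
      · intro v
        simp [θ]
    exact RingHom.congr_fun this p
  refine ⟨θ, le_antisymm ?_ ?_, fun v => by simp [θ]⟩
  · intro G hG
    rw [RingHom.mem_ker] at hG
    let ρ : MvPolynomial V R →+* MvPolynomial V F := eval₂Hom j₁ X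
    have hρ : ∀ p,
        Ideal.Quotient.mk I (map (algebraMap R K) p) = Ideal.Quotient.mk I (map i (ρ p)) := by
      intro p
      have : (Ideal.Quotient.mk I).comp (map (algebraMap R K)) =
          ((Ideal.Quotient.mk I).comp (map i)).comp ρ := by
        apply MvPolynomial.ringHom_ext
        · intro r
          simp only [RingHom.comp_apply, map_C, ρ, coe_eval₂Hom, eval₂_C]
          symm
          rw [Ideal.Quotient.eq]
          exact Ideal.subset_span (Or.inr ⟨r, rfl⟩)
        · intro v
          simp [ρ]
      exact RingHom.congr_fun this p
    have hmk : ∀ p, Ideal.Quotient.mk I (map i (linSubst T p)) = Ideal.Quotient.mk I (map i p) :=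
      comp_linSubst W T hT ((Ideal.Quotient.mk I).comp (map i)) fun w hw =>
        Ideal.Quotient.eq_zero_iff_mem.mpr (Ideal.subset_span (Or.inl ⟨w, hw, rfl⟩))
    let : Algebra (MvPolynomial V R) (MvPolynomial V K) := algebraMvPolynomial
    obtain ⟨⟨G1, ⟨_, s, hs, rfl⟩⟩, hG1⟩ :=
      IsLocalization.surj ((nonZeroDivisors R).map (C (σ := V))) G
    have hs0 : algebraMap R K s ≠ 0 :=
      have := (algebraMap R K).domain_nontrivial
      IsFractionRing.to_map_ne_zero_of_mem_nonZeroDivisors hs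
    have halg : ∀ p : MvPolynomial V R, algebraMap (MvPolynomial V R) (MvPolynomial V K) p =
      map (algebraMap R K) p := fun p => rfl
    simp only [halg, map_C] at hG1
    have h1 : algebraMap (MvPolynomial V F) L (linSubst T (ρ G1)) = 0 := by
      have h2 := congrArg θ hG1
      rw [map_mul, hG, zero_mul] at h2
      rw [h2, ← hθδ]
      have : θ.comp (map (algebraMap R K)) = (θ.comp (map i)).comp ρ := by
        apply MvPolynomial.ringHom_ext
        · intro r
          simp only [RingHom.comp_apply, hθδ]
          simp [θ, ρ, hjK]
        · intro v
          simp [ρ]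
      exact (RingHom.congr_fun this G1).symm
    have h2 : linSubst T (ρ G1) = 0 :=
      IsFractionRing.injective (MvPolynomial V F) L (by rw [h1, map_zero])
    have h3 := congrArg (Ideal.Quotient.mk I) hG1
    rw [hρ, ← hmk, h2, map_zero, map_zero, Ideal.Quotient.eq_zero_iff_mem] at h3
    have h4 := I.mul_mem_right (C (algebraMap R K s)⁻¹) h3
    rwa [mul_assoc, ← C_mul, mul_inv_cancel₀ hs0, C_1, mul_one] at h4
  · rw [hI, Ideal.span_le]
    rintro g (⟨w, hw, rfl⟩ | ⟨r, rfl⟩)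
    · simp only [SetLike.mem_coe, RingHom.mem_ker, hθδ, linSubst_linForm, hT0 w hw, map_zero]
    · simp only [SetLike.mem_coe, RingHom.mem_ker, map_sub, hθδ, sub_eq_zero]
      simp [θ, hjK]

theorem eqnSystem_prime (i : F →+* K) (W : Submodule F (V → F))
    (j₁ : R →+* MvPolynomial V F)
    (hi : ∀ x, ∃ a b, b ≠ 0 ∧ i x * algebraMap R K b = algebraMap R K a ∧
      j₁ a = C x * j₁ b) (η : V → Ω) (hη : ∀ g ∈ eqnSystem i W j₁, aeval η g = 0) :
    (Ideal.span (eqnSystem i W j₁)).IsPrime ∧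
      ∀ v, X v ∈ Ideal.span (eqnSystem i W j₁) →
        (X v : MvPolynomial V F) ∈ linForm '' (W : Set (V → F)) := by
  classical
  obtain ⟨T, hT0, hT⟩ := exists_linear_retraction W
  have hj := linSubst_comp_injective i W j₁ η hη T hT
  obtain ⟨θ, hθ, hX⟩ := exists_ker_eq_span (L := FractionRing (MvPolynomial V F))
    i W j₁ hi T hT0 hT hj
  rw [← hθ]
  refine ⟨RingHom.ker_isPrime θ, fun v hv => ⟨Pi.single v 1, ?_, linForm_single v⟩⟩
  rw [RingHom.mem_ker, hX, linSubst_X] at hv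
  have h1 : linForm (T (Pi.single v 1)) = 0 :=
    IsFractionRing.injective (MvPolynomial V F) (FractionRing (MvPolynomial V F))
      (by rw [hv, map_zero])
  have h2 : T (Pi.single v 1) = 0 := by
    ext u
    rw [← coeff_linForm (T _) u, h1]; simp
  have h3 := hT (Pi.single v 1)
  rwa [h2, sub_zero] at h3

end

end

section
open MvPolynomial

/-- Rational functions in the second group of parameters, viewed in all parameters. -/
def paramIncl (E P : Type*) : MvPolynomial P ℂ →+* RatFuncField (E ⊕ P) :=
  (algebraMap (MvPolynomial (E ⊕ P) ℂ) (RatFuncField (E ⊕ P))).comp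
    (rename (R := ℂ) (Sum.inr : P → E ⊕ P)).toRingHom

/-- The system of equations `Q_e = a_e` together with linear forms with coefficients in `ℂ[c]`. -/
def paramSystem {E P V : Type*} [Fintype V] (Q : E → MvPolynomial V ℂ)
    (W : Set (V → MvPolynomial P ℂ)) : Set (MvPolynomial V (RatFuncField (E ⊕ P))) :=
  Set.range (fun e => map (algebraMap ℂ (RatFuncField (E ⊕ P))) (Q e) -
      C (ratParam (Sum.inl e : E ⊕ P))) ∪
    (fun w => linForm fun v => paramIncl E P (w v)) '' W

theorem paramIncl_injective (E P : Type*) : Function.Injective (paramIncl E P) :=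
  (IsFractionRing.injective (MvPolynomial (E ⊕ P) ℂ) (RatFuncField (E ⊕ P))).comp
    (rename_injective _ Sum.inr_injective)

/-- The inclusion of fraction fields induced by `paramIncl`. -/
def paramInclField (E P : Type*) : RatFuncField P →+* RatFuncField (E ⊕ P) :=
  IsFractionRing.lift (paramIncl_injective E P)

theorem paramInclField_algebraMap {E P : Type*} (x : MvPolynomial P ℂ) :
    paramInclField E P (algebraMap (MvPolynomial P ℂ) (RatFuncField P) x) = paramIncl E P x :=
  IsFractionRing.lift_algebraMap (paramIncl_injective E P) x

/-- Substitution of `Q_e` for the parameter `a_e`. -/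
def paramSubst {E P V : Type*} (Q : E → MvPolynomial V ℂ) :
    MvPolynomial (E ⊕ P) ℂ →ₐ[ℂ] MvPolynomial V (RatFuncField P) :=
  aeval (Sum.elim (fun e => map (algebraMap ℂ (RatFuncField P)) (Q e))
    (fun c => C (ratParam c)))

theorem paramSubst_rename {E P V : Type*} (Q : E → MvPolynomial V ℂ) (a : MvPolynomial P ℂ) :
    paramSubst Q (rename Sum.inr a) = C (algebraMap (MvPolynomial P ℂ) (RatFuncField P) a) := by
  have : (paramSubst Q).comp (rename Sum.inr) =
      (IsScalarTower.toAlgHom ℂ (RatFuncField P) (MvPolynomial V (RatFuncField P))).comp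
        (IsScalarTower.toAlgHom ℂ (MvPolynomial P ℂ) (RatFuncField P)) := by
    apply MvPolynomial.algHom_ext
    intro c
    simp [paramSubst, ratParam, algebraMap_eq]
  exact AlgHom.congr_fun this a

/-- The span over the rational function field of the coefficient vectors `W`. -/
def paramSpan {P V : Type*} (W : Set (V → MvPolynomial P ℂ)) :
    Submodule (RatFuncField P) (V → RatFuncField P) :=
  Submodule.span _ ((fun w v => algebraMap (MvPolynomial P ℂ) (RatFuncField P) (w v)) '' W)

theorem paramSpan_vanish {P V S : Type*} [CommRing S] [Fintype V] (W : Set (V → MvPolynomial P ℂ))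
    (g : RatFuncField P →+* S) (ξ : V → S)
    (h : ∀ w ∈ W, ∑ u, g (algebraMap (MvPolynomial P ℂ) _ (w u)) * ξ u = 0) :
    ∀ w ∈ paramSpan W, ∑ u, g (w u) * ξ u = 0 := by
  intro w hw
  induction hw using Submodule.span_induction with
  | mem x hx => obtain ⟨y, hy, rfl⟩ := hx; exact h y hy
  | zero => simp
  | add x y _ _ hx hy => simp [add_mul, Finset.sum_add_distrib, hx, hy]
  | smul a x _ hx => simp [mul_assoc, ← Finset.mul_sum, hx]

theorem span_paramSystem {E P V : Type*} [Fintype V] (Q : E → MvPolynomial V ℂ)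
    (W : Set (V → MvPolynomial P ℂ)) :
    Ideal.span (paramSystem Q W) =
      Ideal.span (eqnSystem (paramInclField E P) (paramSpan W) (paramSubst Q).toRingHom) := by
  apply le_antisymm
  · rw [Ideal.span_le]
    rintro g (⟨e, rfl⟩ | ⟨w, hw, rfl⟩)
    · apply Ideal.subset_span
      refine Or.inr ⟨X (Sum.inl e), ?_⟩
      simp only [AlgHom.toRingHom_eq_coe, RingHom.coe_coe, paramSubst, aeval_X, Sum.elim_inl,
        map_map, ratParam]
      congr 2
      congr 1
      ext r
      rw [RingHom.comp_apply, IsScalarTower.algebraMap_apply ℂ (MvPolynomial P ℂ) (RatFuncField P),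
        paramInclField_algebraMap]
      simp [paramIncl, algebraMap_eq,
        IsScalarTower.algebraMap_apply ℂ (MvPolynomial (E ⊕ P) ℂ) (RatFuncField (E ⊕ P))]
    · apply Ideal.subset_span
      refine Or.inl ⟨_, Submodule.subset_span ⟨w, hw, rfl⟩, ?_⟩
      simp only [map_linForm, paramInclField_algebraMap]
  · rw [Ideal.span_le]
    rintro g (⟨w, hw, rfl⟩ | ⟨r, rfl⟩)
    · rw [SetLike.mem_coe, ← Ideal.Quotient.eq_zero_iff_mem]
      have := paramSpan_vanish (S := MvPolynomial V (RatFuncField (E ⊕ P)) ⧸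
          Ideal.span (paramSystem Q W)) W
        ((Ideal.Quotient.mk (Ideal.span (paramSystem Q W))).comp (C.comp (paramInclField E P)))
        (fun v => Ideal.Quotient.mk (Ideal.span (paramSystem Q W)) (X v)) ?_ w hw
      · simpa [linForm_apply] using this
      · intro w hw
        have h1 : (linForm fun v => paramIncl E P (w v)) ∈ Ideal.span (paramSystem Q W) :=
          Ideal.subset_span (Or.inr ⟨w, hw, rfl⟩)
        rw [← Ideal.Quotient.eq_zero_iff_mem] at h1
        simpa [linForm_apply, paramInclField_algebraMap] using h1
    · rw [SetLike.mem_coe, ← Ideal.Quotient.eq]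
      have : ((Ideal.Quotient.mk (Ideal.span (paramSystem Q W))).comp
          (map (paramInclField E P))).comp (paramSubst Q).toRingHom =
          (Ideal.Quotient.mk (Ideal.span (paramSystem Q W))).comp
            (C.comp (algebraMap (MvPolynomial (E ⊕ P) ℂ) (RatFuncField (E ⊕ P)))) := by
        have hc : ∀ r : ℂ, paramInclField E P (algebraMap ℂ (RatFuncField P) r) =
            algebraMap (MvPolynomial (E ⊕ P) ℂ) (RatFuncField (E ⊕ P)) (C r) := by
          intro r
          rw [IsScalarTower.algebraMap_apply ℂ (MvPolynomial P ℂ) (RatFuncField P),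
            paramInclField_algebraMap]
          simp [paramIncl, algebraMap_eq]
        apply MvPolynomial.ringHom_ext
        · intro r
          simp only [RingHom.comp_apply, AlgHom.toRingHom_eq_coe, RingHom.coe_coe]
          rw [← algebraMap_eq, AlgHom.commutes,
            IsScalarTower.algebraMap_apply ℂ (RatFuncField P) (MvPolynomial V (RatFuncField P)),
            algebraMap_eq, map_C, hc, algebraMap_eq]
        · rintro (e | c)
          · have h1 : _ ∈ Ideal.span (paramSystem Q W) := Ideal.subset_span (Or.inl ⟨e, rfl⟩)
            rw [← Ideal.Quotient.eq] at h1
            simp only [RingHom.comp_apply, AlgHom.toRingHom_eq_coe, RingHom.coe_coe, paramSubst,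
              aeval_X, Sum.elim_inl, map_map]
            refine Eq.trans ?_ h1
            congr 2
            congr 1
            ext r
            rw [RingHom.comp_apply, hc,
              IsScalarTower.algebraMap_apply ℂ (MvPolynomial (E ⊕ P) ℂ) (RatFuncField (E ⊕ P)),
              algebraMap_eq]
          · simp [paramSubst, ratParam, paramInclField_algebraMap, paramIncl]
      exact RingHom.congr_fun this r

theorem paramSystem_prime {E P V Ω : Type*} [Fintype V] [Field Ω] [Algebra (RatFuncField (E ⊕ P)) Ω]
    (Q : E → MvPolynomial V ℂ) (W : Set (V → MvPolynomial P ℂ)) (η : V → Ω)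
    (hη : ∀ g ∈ paramSystem Q W, aeval η g = 0) :
    (Ideal.span (paramSystem Q W)).IsPrime ∧
      ∀ (v : V) (ξ : V → Ω),
        (∀ w ∈ W, ∑ u, algebraMap (RatFuncField (E ⊕ P)) Ω (paramIncl E P (w u)) * ξ u = 0) →
        ξ v ≠ 0 → X v ∉ Ideal.span (paramSystem Q W) := by
  classical
  have hη' : ∀ g ∈ Ideal.span (paramSystem Q W), aeval η g = 0 := by
    intro g hg
    have : Ideal.span (paramSystem Q W) ≤ RingHom.ker (aeval η) := Ideal.span_le.mpr hη
    exact this hg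
  rw [span_paramSystem] at hη' ⊢
  have hi : ∀ x, ∃ a b, b ≠ 0 ∧
      paramInclField E P x * algebraMap (MvPolynomial (E ⊕ P) ℂ) (RatFuncField (E ⊕ P)) b =
        algebraMap (MvPolynomial (E ⊕ P) ℂ) (RatFuncField (E ⊕ P)) a ∧
      (paramSubst Q).toRingHom a =
        (C x : MvPolynomial V (RatFuncField P)) * (paramSubst Q).toRingHom b := by
    intro x
    obtain ⟨a, b, hb, rfl⟩ := IsFractionRing.div_surjective (A := MvPolynomial P ℂ) x
    have hb0 : b ≠ 0 := nonZeroDivisors.ne_zero hb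
    have hbF : algebraMap (MvPolynomial P ℂ) (RatFuncField P) b ≠ 0 :=
      IsFractionRing.to_map_ne_zero_of_mem_nonZeroDivisors hb
    refine ⟨rename Sum.inr a, rename Sum.inr b, ?_, ?_, ?_⟩
    · intro h
      exact hb0 (rename_injective _ Sum.inr_injective (by rw [h, map_zero]))
    · have hbK : paramInclField E P (algebraMap (MvPolynomial P ℂ) (RatFuncField P) b) ≠ 0 := by
        simpa using hbF
      rw [map_div₀, paramInclField_algebraMap, paramInclField_algebraMap]
      rw [paramInclField_algebraMap] at hbK
      exact div_mul_cancel₀ _ hbK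
    · simp only [AlgHom.toRingHom_eq_coe, RingHom.coe_coe, paramSubst_rename]
      rw [← C_mul, div_mul_cancel₀ _ hbF]
  obtain ⟨h1, h2⟩ := eqnSystem_prime (paramInclField E P) (paramSpan W) (paramSubst Q).toRingHom
    hi η fun g hg => hη' g (Ideal.subset_span hg)
  refine ⟨h1, fun v ξ hξ hv hX => hv ?_⟩
  obtain ⟨w, hw, hwX⟩ := h2 v hX
  have := paramSpan_vanish W ((algebraMap (RatFuncField (E ⊕ P)) Ω).comp (paramInclField E P)) ξ
    (by simpa [paramInclField_algebraMap] using hξ) w hw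
  have hw1 : w = Pi.single v 1 := by
    ext u
    rw [← coeff_linForm w u, hwX, ← linForm_single, coeff_linForm]
  rw [hw1] at this
  simpa [Pi.single_apply] using this

end

section
open MvPolynomial

section
variable {K Ω V : Type*} [Field K] [Field Ω] [Algebra K Ω]

/-- The common zeros in `Ω` of a set of polynomials over `K`. -/
def zeroSet (Ω : Type*) [Field Ω] [Algebra K Ω] (S : Set (MvPolynomial V K)) : Set (V → Ω) :=
  {η | ∀ g ∈ S, aeval η g = 0}

/-- Algebra homomorphisms from a quotient of a polynomial ring correspond to zeros. -/
def homEquivZeroSet (S : Set (MvPolynomial V K)) :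
    ((MvPolynomial V K ⧸ Ideal.span S) →ₐ[K] Ω) ≃ zeroSet Ω S where
  toFun φ := ⟨fun v => φ (Ideal.Quotient.mk _ (X v)), fun g hg => by
    have : aeval (fun v => φ (Ideal.Quotient.mk (Ideal.span S) (X v))) =
        φ.comp (Ideal.Quotient.mkₐ K (Ideal.span S)) := by
      apply MvPolynomial.algHom_ext; intro v; simp
    rw [this, AlgHom.comp_apply, Ideal.Quotient.mkₐ_eq_mk,
      Ideal.Quotient.eq_zero_iff_mem.mpr (Ideal.subset_span hg), map_zero]⟩
  invFun η := Ideal.Quotient.liftₐ _ (aeval η.1) fun a ha => by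
    have : Ideal.span S ≤ RingHom.ker (aeval η.1) := Ideal.span_le.mpr η.2
    exact this ha
  left_inv φ := by
    apply Ideal.Quotient.algHom_ext
    apply MvPolynomial.algHom_ext
    intro v
    exact aeval_X _ v
  right_inv η := by
    ext v
    exact aeval_X _ v

theorem homEquivZeroSet_symm_mk (S : Set (MvPolynomial V K)) (η : zeroSet Ω S)
    (g : MvPolynomial V K) :
    (homEquivZeroSet S).symm η (Ideal.Quotient.mk _ g) = aeval η.1 g := rfl

theorem aeval_homEquivZeroSet (S : Set (MvPolynomial V K))
    (φ : (MvPolynomial V K ⧸ Ideal.span S) →ₐ[K] Ω) (g : MvPolynomial V K) :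
    aeval (homEquivZeroSet S φ).1 g = φ (Ideal.Quotient.mk _ g) := by
  rw [← homEquivZeroSet_symm_mk, Equiv.symm_apply_apply]

variable [IsAlgClosed Ω] [Finite V]

theorem isIntegral_mk_of_finite_values {S : Set (MvPolynomial V K)} (b : MvPolynomial V K)
    (hfin : ((fun η => aeval η b) '' zeroSet Ω S).Finite) :
    IsIntegral K (Ideal.Quotient.mk (Ideal.span S) b) := by
  apply isIntegral_of_finite_values (Ω := Ω)
  refine hfin.subset ?_
  rintro _ ⟨φ, rfl⟩
  exact ⟨_, (homEquivZeroSet S φ).2, aeval_homEquivZeroSet S φ b⟩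

theorem aeval_ne_zero_of_finite_values {S : Set (MvPolynomial V K)} (hS : (Ideal.span S).IsPrime)
    (b : MvPolynomial V K) (hb : b ∉ Ideal.span S)
    (hfin : ((fun η => aeval η b) '' zeroSet Ω S).Finite) {η : V → Ω} (hη : η ∈ zeroSet Ω S) :
    aeval η b ≠ 0 := by
  have h1 := isIntegral_mk_of_finite_values b hfin
  have h2 : IsUnit (Ideal.Quotient.mk (Ideal.span S) b) := by
    apply h1.isUnit
    rwa [Ne, Ideal.Quotient.eq_zero_iff_mem]
  have h3 := (h2.map ((homEquivZeroSet S).symm ⟨η, hη⟩)).ne_zero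
  rwa [homEquivZeroSet_symm_mk] at h3

theorem isField_and_finrank [CharZero K] {S : Set (MvPolynomial V K)}
    (hS : (Ideal.span S).IsPrime) (hfin : (zeroSet Ω S).Finite) :
    (Ideal.span S).IsMaximal ∧
      Module.finrank K (MvPolynomial V K ⧸ Ideal.span S) = (zeroSet Ω S).ncard := by
  have hint : Algebra.IsIntegral K (MvPolynomial V K ⧸ Ideal.span S) := by
    have htop :
        Algebra.adjoin K (Set.range fun v : V => Ideal.Quotient.mk (Ideal.span S) (X v)) = ⊤ := by
      have h0 := congrArg (Subalgebra.map (Ideal.Quotient.mkₐ K (Ideal.span S)))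
        (MvPolynomial.adjoin_range_X (R := K) (σ := V))
      rw [AlgHom.map_adjoin, ← Set.range_comp, Algebra.map_top,
        (AlgHom.range_eq_top _).mpr (Ideal.Quotient.mkₐ_surjective K _)] at h0
      exact h0
    rw [← integralClosure_eq_top_iff, eq_top_iff, ← htop, Algebra.adjoin_le_iff]
    rintro _ ⟨v, rfl⟩
    exact isIntegral_mk_of_finite_values (Ω := Ω) _ (hfin.image _)
  have hfld : IsField (MvPolynomial V K ⧸ Ideal.span S) :=
    isField_of_isIntegral_of_isField' (Field.toIsField K)
  refine ⟨Ideal.Quotient.maximal_of_isField _ hfld, ?_⟩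
  let _ := hfld.toField
  have : Algebra.IsIntegral K (MvPolynomial V K ⧸ Ideal.span S) := hint
  have hft : Algebra.FiniteType K (MvPolynomial V K ⧸ Ideal.span S) := inferInstance
  have : Module.Finite K (MvPolynomial V K ⧸ Ideal.span S) := Algebra.IsIntegral.finite
  have h := AlgHom.card K (MvPolynomial V K ⧸ Ideal.span S) Ω
  rw [← h, ← Nat.card_coe_set_eq, ← Nat.card_eq_fintype_card]
  exact Nat.card_congr (homEquivZeroSet S)

end

end

section
open MvPolynomial

section
variable {K V : Type*} [Field K]

/-- Evaluation of Laurent polynomials at nonzero elements of a field. -/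
def laurentEval {B : Type*} [Field B] [Algebra K B] (x : V → B) (hx : ∀ v, x v ≠ 0) :
    LaurentRing K V →ₐ[K] B :=
  AddMonoidAlgebra.lift K B (V →₀ ℤ)
    { toFun := fun f => f.toAdd.prod fun v m => x v ^ m
      map_one' := Finsupp.prod_zero_index
      map_mul' := fun f g => by
        rw [toAdd_mul]
        exact Finsupp.prod_add_index' (fun _ => zpow_zero _) fun v a b => zpow_add₀ (hx v) a b }

theorem laurentEval_LX {B : Type*} [Field B] [Algebra K B] (x : V → B) (hx : ∀ v, x v ≠ 0) (v : V) :
    laurentEval (K := K) x hx (LX v) = x v := by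
  simp [laurentEval, LX]

theorem laurent_algHom_ext {B : Type*} [CommRing B] [Algebra K B] {f g : LaurentRing K V →ₐ[K] B}
    (h : ∀ v, f (LX v) = g (LX v)) : f = g := by
  have key : ∀ v, ((f : LaurentRing K V →* B).comp (AddMonoidAlgebra.of K (V →₀ ℤ))).comp
        (Finsupp.singleAddHom v : ℤ →+ (V →₀ ℤ)).toMultiplicative =
      ((g : LaurentRing K V →* B).comp (AddMonoidAlgebra.of K (V →₀ ℤ))).comp
        (Finsupp.singleAddHom v : ℤ →+ (V →₀ ℤ)).toMultiplicative := fun v =>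
    MonoidHom.ext_mint (h v)
  have :
      MonoidHom.toAdditiveRight
        ((f : LaurentRing K V →* B).comp (AddMonoidAlgebra.of K (V →₀ ℤ))) =
      MonoidHom.toAdditiveRight
        ((g : LaurentRing K V →* B).comp (AddMonoidAlgebra.of K (V →₀ ℤ))) := by
    apply Finsupp.addHom_ext
    intro v m
    exact DFunLike.congr_fun (key v) (Multiplicative.ofAdd m)
  apply AddMonoidAlgebra.algHom_ext
  · intro m
    exact DFunLike.congr_fun this m
  · ext

/-- The inclusion of polynomials in Laurent polynomials. -/
def toLaurent (K V : Type*) [Field K] : MvPolynomial V K →ₐ[K] LaurentRing K V := aeval LX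

theorem finrank_laurent_quotient {S : Set (MvPolynomial V K)} (hS : (Ideal.span S).IsMaximal)
    (hX : ∀ v, X v ∉ Ideal.span S) :
    Module.finrank K (LaurentRing K V ⧸ Ideal.span (toLaurent K V '' S)) =
      Module.finrank K (MvPolynomial V K ⧸ Ideal.span S) := by
  let _ := Ideal.Quotient.field (Ideal.span S)
  have hx : ∀ v, Ideal.Quotient.mk (Ideal.span S) (X v) ≠ 0 := fun v h =>
    hX v (Ideal.Quotient.eq_zero_iff_mem.mp h)
  let φ : LaurentRing K V →ₐ[K] (MvPolynomial V K ⧸ Ideal.span S) := laurentEval _ hx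
  have hφ : φ.comp (toLaurent K V) = Ideal.Quotient.mkₐ K (Ideal.span S) := by
    apply MvPolynomial.algHom_ext
    intro v
    simp [φ, toLaurent, laurentEval_LX]
  have hφJ : ∀ a ∈ Ideal.span (toLaurent K V '' S), φ a = 0 := by
    have : Ideal.span (toLaurent K V '' S) ≤ RingHom.ker φ := by
      rw [Ideal.span_le]
      rintro _ ⟨p, hp, rfl⟩
      have := AlgHom.congr_fun hφ p
      rw [AlgHom.comp_apply] at this
      rw [SetLike.mem_coe, RingHom.mem_ker, this]
      exact Ideal.Quotient.eq_zero_iff_mem.mpr (Ideal.subset_span hp)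
    exact this
  let ψ : MvPolynomial V K →ₐ[K] (LaurentRing K V ⧸ Ideal.span (toLaurent K V '' S)) :=
    (Ideal.Quotient.mkₐ K _).comp (toLaurent K V)
  have hψI : ∀ a ∈ Ideal.span S, ψ a = 0 := by
    have : Ideal.span S ≤ RingHom.ker ψ := by
      rw [Ideal.span_le]
      intro p hp
      exact Ideal.Quotient.eq_zero_iff_mem.mpr (Ideal.subset_span ⟨p, hp, rfl⟩)
    exact this
  let φ' := Ideal.Quotient.liftₐ _ φ hφJ
  let ψ' := Ideal.Quotient.liftₐ _ ψ hψI
  have h1 : φ'.comp ψ' = AlgHom.id K _ := by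
    apply Ideal.Quotient.algHom_ext
    exact hφ
  have h2 : ψ'.comp φ' = AlgHom.id K _ := by
    apply Ideal.Quotient.algHom_ext
    apply laurent_algHom_ext
    intro v
    change ψ' (φ (LX v)) = Ideal.Quotient.mk _ (LX v)
    rw [laurentEval_LX]
    exact congrArg (Ideal.Quotient.mk _) (aeval_X (LX (K := K)) v)
  exact (AlgEquiv.ofAlgHom φ' ψ' h1 h2).toLinearEquiv.finrank_eq

end

end

section
open MvPolynomial

theorem finrank_laurent_paramSystem {E P V Ω : Type*} [Fintype V] [Field Ω] [IsAlgClosed Ω]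
    [Algebra (RatFuncField (E ⊕ P)) Ω]
    (Q : E → MvPolynomial V ℂ) (W : Set (V → MvPolynomial P ℂ))
    (hfin : (zeroSet Ω (paramSystem Q W)).Finite) (hne : (zeroSet Ω (paramSystem Q W)).Nonempty)
    (hξ : ∀ v, ∃ ξ : V → Ω,
      (∀ w ∈ W, ∑ u, algebraMap (RatFuncField (E ⊕ P)) Ω (paramIncl E P (w u)) * ξ u = 0) ∧
        ξ v ≠ 0) :
    Module.finrank (RatFuncField (E ⊕ P)) (LaurentRing (RatFuncField (E ⊕ P)) V ⧸
      Ideal.span (toLaurent (RatFuncField (E ⊕ P)) V '' paramSystem Q W)) =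
      (zeroSet Ω (paramSystem Q W)).ncard := by
  obtain ⟨η, hη⟩ := hne
  obtain ⟨hprime, hX⟩ := paramSystem_prime Q W η hη
  have : CharZero (RatFuncField (E ⊕ P)) :=
    charZero_of_injective_algebraMap (algebraMap ℂ (RatFuncField (E ⊕ P))).injective
  obtain ⟨hmax, hcard⟩ := isField_and_finrank hprime hfin
  rw [← hcard]
  refine finrank_laurent_quotient hmax fun v => ?_
  obtain ⟨ξ, h1, h2⟩ := hξ v
  exact hX v ξ h1 h2

end

section
open MvPolynomial

/-- The squared length of an edge, as a polynomial in the coordinates of a realisation. -/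
def sqLen (R : Type*) [CommRing R] {n : ℕ} (d : ℕ) (e : Sym2 (Fin n)) :
    MvPolynomial (Fin n × Fin d) R :=
  Sym2.lift ⟨fun i j => ∑ k, (X (i, k) - X (j, k)) ^ 2,
    fun i j => Finset.sum_congr rfl fun k _ => by ring⟩ e

theorem sqLen_mk (R : Type*) [CommRing R] {n : ℕ} (d : ℕ) (i j : Fin n) :
    sqLen R d s(i, j) = ∑ k, (X (i, k) - X (j, k)) ^ 2 := rfl

theorem map_sqLen {R S : Type*} [CommRing R] [CommRing S] (g : R →+* S) {n : ℕ} (d : ℕ)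
    (e : Sym2 (Fin n)) : map g (sqLen R d e) = sqLen S d e := by
  induction e with
  | _ i j => simp [sqLen_mk]

theorem aeval_sqLen_mk {R S : Type*} [CommRing R] [CommRing S] [Algebra R S] {n d : ℕ}
    (q : Fin n → Fin d → S) (i j : Fin n) :
    aeval (fun v : Fin n × Fin d => q v.1 v.2) (sqLen R d s(i, j)) = ∑ k, (q i k - q j k) ^ 2 := by
  simp [sqLen_mk]

theorem eval_sqLen_mk {R : Type*} [CommRing R] {n d : ℕ}
    (q : Fin n → Fin d → R) (i j : Fin n) :
    eval (fun v : Fin n × Fin d => q v.1 v.2) (sqLen R d s(i, j)) = ∑ k, (q i k - q j k) ^ 2 := by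
  simp [sqLen_mk]

theorem eval_eq_of_mem_adjoin {σ : Type*} {A : Set (MvPolynomial σ ℝ)} {p q : σ → ℝ}
    (h : ∀ a ∈ A, eval q a = eval p a) {a : MvPolynomial σ ℝ} (ha : a ∈ Algebra.adjoin ℝ A) :
    eval q a = eval p a := by
  have : Algebra.adjoin ℝ A ≤ AlgHom.equalizer (aeval q) (aeval p) := by
    rw [Algebra.adjoin_le_iff]
    intro a ha
    simpa [aeval_eq_eval] using h a ha
  simpa [aeval_eq_eval] using this ha

theorem sqLen_algebraicIndependent {n d : ℕ} {G : SimpleGraph (Fin n)}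
    (hG : IsMinimallyRigidGraph G d) :
    AlgebraicIndependent ℝ (fun e : G.edgeSet => sqLen ℝ d (e : Sym2 (Fin n))) := by
  refine algebraicIndependent_of_finite_type' (C_injective _ _) ?_
  rintro t - - e he ⟨P, hP, hPe⟩
  obtain ⟨f, hf, hrig⟩ := hG.1
  have hlead : ((P.leadingCoeff : _) : MvPolynomial (Fin n × Fin d) ℝ) ≠ 0 := by
    simpa using hP
  refine hG.2 e e.2 ⟨f * (P.leadingCoeff : MvPolynomial (Fin n × Fin d) ℝ),
    mul_ne_zero hf hlead, ?_⟩
  intro p hp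
  rw [map_mul] at hp
  have hp1 := left_ne_zero_of_mul hp
  have hp2 := right_ne_zero_of_mul hp
  intro q hqc hq0 hq t' ht'
  refine hrig p hp1 q hqc hq0 ?_ t' ht'
  let ev : (Fin n → Fin d → ℝ) → MvPolynomial (Fin n × Fin d) ℝ →+* ℝ := fun q =>
    eval fun v => q v.1 v.2
  let Pp : Polynomial ℝ := P.map ((ev p).comp (algebraMap _ (MvPolynomial (Fin n × Fin d) ℝ)))
  have hPp : Pp ≠ 0 := by
    intro h
    have := congrArg (fun Q => Polynomial.coeff Q P.natDegree) h
    simp only [Pp, Polynomial.coeff_map, Polynomial.coeff_zero] at this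
    exact hp2 this
  have hedge : ∀ t ∈ Set.Icc (0 : ℝ) 1, ∀ e' : G.edgeSet, e' ≠ e →
      ev (q t) (sqLen ℝ d (e' : Sym2 (Fin n))) = ev p (sqLen ℝ d (e' : Sym2 (Fin n))) := by
    rintro t ht ⟨e', he'⟩ hne
    have hne' : e' ≠ e := fun h => hne (Subtype.ext h)
    induction e' with
    | _ i j =>
      simp only [ev, eval_sqLen_mk]
      apply hq t ht
      rw [SimpleGraph.deleteEdges_adj]
      exact ⟨he', hne'⟩
  have hroot : ∀ t ∈ Set.Icc (0 : ℝ) 1,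
      ev (q t) (sqLen ℝ d (e : Sym2 (Fin n))) ∈ Pp.roots.toFinset := by
    intro s hs
    rw [Multiset.mem_toFinset, Polynomial.mem_roots hPp, Polynomial.IsRoot]
    have h1 : Pp = P.map ((ev (q s)).comp (algebraMap _ (MvPolynomial (Fin n × Fin d) ℝ))) := by
      ext m
      simp only [Pp, Polynomial.coeff_map]
      refine (eval_eq_of_mem_adjoin ?_ (P.coeff m).2).symm
      rintro _ ⟨e', he', rfl⟩
      exact hedge s hs e' fun h => he (h ▸ he')
    have h2 := congrArg (ev (q s)) hPe
    rw [Polynomial.aeval_def, map_zero, Polynomial.hom_eval₂] at h2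
    rw [h1, Polynomial.eval_map]
    exact h2
  have hcont : ContinuousOn (fun t => ev (q t) (sqLen ℝ d (e : Sym2 (Fin n)))) (Set.Icc 0 1) := by
    have h1 : Continuous fun p : Fin n → Fin d → ℝ => ev p (sqLen ℝ d (e : Sym2 (Fin n))) := by
      have h2 := MvPolynomial.continuous_eval (sqLen ℝ d (e : Sym2 (Fin n)))
      exact h2.comp (by fun_prop :
        Continuous fun (p : Fin n → Fin d → ℝ) (v : Fin n × Fin d) => p v.1 v.2)
    exact h1.comp_continuousOn hqc
  have hconst : ∀ t ∈ Set.Icc (0 : ℝ) 1, ev (q t) (sqLen ℝ d (e : Sym2 (Fin n))) =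
      ev p (sqLen ℝ d (e : Sym2 (Fin n))) := by
    intro s hs
    have hpre := (isPreconnected_Icc (a := (0 : ℝ)) (b := 1)).image _ hcont
    have hsub :
        ((fun t => ev (q t) (sqLen ℝ d (e : Sym2 (Fin n)))) '' Set.Icc 0 1).Subsingleton := by
      rw [← Set.not_nontrivial_iff]
      intro hnt
      refine hpre.infinite_of_nontrivial hnt (Pp.roots.toFinset.finite_toSet.subset ?_)
      rintro _ ⟨s, hs, rfl⟩
      exact hroot s hs
    have h := hsub ⟨s, hs, rfl⟩ ⟨0, by simp, rfl⟩
    simpa only [hq0] using h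
  intro s hs i j hij
  have key : ∀ e' : G.edgeSet, ev (q s) (sqLen ℝ d (e' : Sym2 (Fin n))) =
      ev p (sqLen ℝ d (e' : Sym2 (Fin n))) := by
    intro e'
    by_cases h : e' = e
    · rw [h]; exact hconst s hs
    · exact hedge s hs e' h
  have := key ⟨s(i, j), hij⟩
  simpa only [ev, eval_sqLen_mk] using this

end

section
open MvPolynomial

theorem sqLen_algebraicIndependent_complex {n d : ℕ} {G : SimpleGraph (Fin n)}
    (hG : IsMinimallyRigidGraph G d) :
    AlgebraicIndependent ℂ (fun e : G.edgeSet => sqLen ℂ d (e : Sym2 (Fin n))) := by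
  have h1 := (sqLen_algebraicIndependent hG).map' (f := mapAlgHom (Algebra.ofId ℝ ℂ))
    (map_injective _ (algebraMap ℝ ℂ).injective)
  have h2 : (mapAlgHom (σ := Fin n × Fin d) (Algebra.ofId ℝ ℂ)) ∘
      (fun e : G.edgeSet => sqLen ℝ d (e : Sym2 (Fin n))) =
      fun e : G.edgeSet => sqLen ℂ d (e : Sym2 (Fin n)) := by
    ext1 e
    exact map_sqLen (algebraMap ℝ ℂ) d _
  rw [h2] at h1
  exact h1.extendScalars ℂ

theorem edge_param_injective {n d : ℕ} {G : SimpleGraph (Fin n)}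
    (hG : IsMinimallyRigidGraph G d) {P P' : Type*} (ι : P → P') (hι : Function.Injective ι) :
    Function.Injective (aeval (Sum.elim
      (fun e : G.edgeSet =>
        rename (Sum.inl : _ → (Fin n × Fin d) ⊕ P') (sqLen ℂ d (e : Sym2 (Fin n))))
      (fun c : P => X (Sum.inr (ι c)))) :
        MvPolynomial (G.edgeSet ⊕ P) ℂ →ₐ[ℂ] MvPolynomial ((Fin n × Fin d) ⊕ P') ℂ) := by
  rw [injective_iff_map_eq_zero]
  intro f hf
  apply MvPolynomial.funext
  intro z
  rw [map_zero]
  let c0 : P → ℂ := z ∘ Sum.inr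
  let s : MvPolynomial ((Fin n × Fin d) ⊕ P') ℂ →ₐ[ℂ] MvPolynomial (Fin n × Fin d) ℂ :=
    aeval (Sum.elim X fun c => C (Function.extend ι c0 0 c))
  have h1 := congrArg s hf
  rw [map_zero, ← AlgHom.comp_apply] at h1
  have h2 : s.comp (aeval (Sum.elim
      (fun e : G.edgeSet =>
        rename (Sum.inl : _ → (Fin n × Fin d) ⊕ P') (sqLen ℂ d (e : Sym2 (Fin n))))
      (fun c : P => X (Sum.inr (ι c))))) =
      (aeval (fun e : G.edgeSet => sqLen ℂ d (e : Sym2 (Fin n)))).comp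
        (aeval (Sum.elim X (fun c => C (c0 c)))) := by
    apply MvPolynomial.algHom_ext
    rintro (e | c)
    · simp only [s, AlgHom.comp_apply, aeval_X, Sum.elim_inl]
      rw [aeval_rename]
      simp
    · simp only [s, AlgHom.comp_apply, aeval_X, Sum.elim_inr, hι.extend_apply]
      rw [aeval_C, algebraMap_eq]
  rw [h2, AlgHom.comp_apply] at h1
  have h3 := (injective_iff_map_eq_zero _).mp (sqLen_algebraicIndependent_complex hG) _ h1
  have h4 := congrArg (eval (z ∘ Sum.inl)) h3
  rw [map_zero] at h4
  rw [← h4]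
  have h5 : (aeval z : MvPolynomial (G.edgeSet ⊕ P) ℂ →ₐ[ℂ] ℂ) =
      (aeval (z ∘ Sum.inl)).comp (aeval (Sum.elim X (fun c => C (c0 c)))) := by
    apply MvPolynomial.algHom_ext
    rintro (e | c)
    · simp
    · simp [c0]
  have h6 := AlgHom.congr_fun h5 f
  simpa [aeval_eq_eval] using h6

end

section Walks
open SimpleGraph Walk
variable {V A : Type*} {G : SimpleGraph V} [AddCommGroup A]

/-- The sum of a function on darts along a walk. -/
def walkSum (y : G.Dart → A) {u v : V} (w : G.Walk u v) : A := (w.darts.map y).sum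

theorem walkSum_cons (y : G.Dart → A) {u v w : V} (h : G.Adj u v) (p : G.Walk v w) :
    walkSum y (cons h p) = y ⟨(u, v), h⟩ + walkSum y p := by
  simp [walkSum]

theorem walkSum_append (y : G.Dart → A) {u v w : V} (p : G.Walk u v) (q : G.Walk v w) :
    walkSum y (p.append q) = walkSum y p + walkSum y q := by
  simp [walkSum]

theorem walkSum_reverse (y : G.Dart → A) (hy : ∀ a : G.Dart, y a.symm = -y a) {u v : V}
    (p : G.Walk u v) : walkSum y p.reverse = -walkSum y p := by
  induction p with
  | nil => simp [walkSum]
  | cons h p ih =>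
    rw [reverse_cons, walkSum_append, ih, walkSum_cons, walkSum_cons]
    have := hy ⟨(_, _), h⟩
    simp only [Dart.symm_mk, Prod.swap_prod_mk] at this
    rw [this]
    simp [walkSum]

theorem dart_add_walkSum_eq_zero (y : G.Dart → A) (hy : ∀ a : G.Dart, y a.symm = -y a)
    (hcyc : ∀ (v : V) (w : G.Walk v v), w.IsCycle → walkSum y w = 0) {u v : V} (h : G.Adj u v)
    (p : G.Walk v u) (hp : p.IsPath) : y ⟨(u, v), h⟩ + walkSum y p = 0 := by
  by_cases he : s(u, v) ∈ p.edges
  · cases p with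
    | nil => exact absurd h G.irrefl
    | @cons _ w _ h' p =>
      rw [cons_isPath_iff] at hp
      rw [edges_cons, List.mem_cons] at he
      have hw : u = w := by
        rcases he with he | he
        · rw [Sym2.eq_swap, Sym2.congr_right] at he
          exact he
        · exact absurd (p.snd_mem_support_of_mem_edges he) hp.2
      subst hw
      rw [(isPath_iff_nil.mp hp.1).eq_nil, walkSum_cons]
      have := hy ⟨(u, v), h⟩
      simp only [Dart.symm_mk, Prod.swap_prod_mk] at this
      rw [this]
      simp [walkSum]
  · rw [← walkSum_cons]
    exact hcyc u _ ((cons_isCycle_iff p h).mpr ⟨hp, he⟩)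

theorem walkSum_bypass [DecidableEq V] (y : G.Dart → A) (hy : ∀ a : G.Dart, y a.symm = -y a)
    (hcyc : ∀ (v : V) (w : G.Walk v v), w.IsCycle → walkSum y w = 0) {u v : V}
    (p : G.Walk u v) : walkSum y p.bypass = walkSum y p := by
  induction p with
  | nil => rfl
  | cons h p ih =>
    rw [bypass]
    split_ifs with hs
    · have h1 := congrArg (walkSum y) (p.bypass.take_spec hs)
      rw [walkSum_append, ih] at h1
      have h2 := dart_add_walkSum_eq_zero y hy hcyc h _ (p.bypass_isPath.takeUntil hs)
      rw [walkSum_cons, ← h1, ← add_assoc, h2, zero_add]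
    · rw [walkSum_cons, walkSum_cons, ih]

/-- A cocycle on the darts of a connected graph is the coboundary of a potential. -/
theorem exists_potential (hG : G.Preconnected) (o : V)
    (y : G.Dart → A) (hy : ∀ a : G.Dart, y a.symm = -y a)
    (hcyc : ∀ (v : V) (w : G.Walk v v), w.IsCycle → walkSum y w = 0) :
    ∃ q : V → A, q o = 0 ∧ ∀ a : G.Dart, y a = q a.fst - q a.snd := by
  classical
  have hclosed : ∀ (v : V) (w : G.Walk v v), walkSum y w = 0 := fun v w => by
    rw [← walkSum_bypass y hy hcyc, (isPath_iff_nil.mp w.bypass_isPath).eq_nil]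
    rfl
  choose w hw using fun v => exists_true_iff_nonempty.mpr (hG v o)
  refine ⟨fun v => walkSum y (w v), hclosed _ _, fun a => ?_⟩
  have h1 := hclosed _ ((cons a.adj (w a.snd)).append (w a.fst).reverse)
  rw [walkSum_append, walkSum_cons, walkSum_reverse y hy] at h1
  rw [eq_sub_iff_add_eq, ← sub_eq_zero, sub_eq_add_neg]
  exact h1

theorem walkSum_sub (q : V → A) {u v : V} (w : G.Walk u v) :
    walkSum (fun a : G.Dart => q a.fst - q a.snd) w = q u - q v := by
  induction w with
  | nil => simp [walkSum]
  | cons h p ih => rw [walkSum_cons, ih]; simp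

end Walks

theorem sum_sq_mulVec {R : Type*} [CommRing R] {d : ℕ} {A : Matrix (Fin d) (Fin d) R}
    (hA : A.transpose * A = 1) (v : Fin d → R) : ∑ k, (A.mulVec v k) ^ 2 = ∑ k, v k ^ 2 := by
  have h : ∀ u : Fin d → R, ∑ k, u k ^ 2 = u ⬝ᵥ u := fun u => by
    simp [dotProduct, sq]
  rw [h, h, Matrix.dotProduct_mulVec, Matrix.vecMul_mulVec, hA, Matrix.vecMul_one]

theorem IsRigidGraph.preconnected {n d : ℕ} (hd : 1 ≤ d) {G : SimpleGraph (Fin n)}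
    (hG : IsRigidGraph G d) : G.Preconnected := by
  classical
  obtain ⟨f, hf, hrig⟩ := hG
  obtain ⟨z, hz⟩ : ∃ z, MvPolynomial.eval z f ≠ 0 := by
    by_contra! h
    exact hf (MvPolynomial.funext fun z => by rw [h z, map_zero])
  intro u v
  by_contra huv
  let o : Fin d := ⟨0, hd⟩
  let p : Fin n → Fin d → ℝ := fun i k => z (i, k)
  let q : ℝ → Fin n → Fin d → ℝ := fun t i k =>
    p i k + if G.Reachable u i ∧ k = o then t else 0
  have hq : ∀ t ∈ Set.Icc (0 : ℝ) 1, RealCongruent (q t) p := by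
    apply hrig p hz q
    · apply Continuous.continuousOn
      refine continuous_pi fun i => continuous_pi fun k => ?_
      simp only [q]
      split_ifs <;> fun_prop
    · ext i k
      simp [q]
    · intro t _ i j hij
      have : G.Reachable u i ↔ G.Reachable u j :=
        ⟨fun h => h.trans hij.reachable, fun h => h.trans hij.symm.reachable⟩
      simp only [q, this]
      refine Finset.sum_congr rfl fun k _ => ?_
      ring
  have hdist : ∀ t ∈ Set.Icc (0 : ℝ) 1, 2 * t * (p u o - p v o) + t ^ 2 = 0 := by
    intro t ht
    obtain ⟨A, x, -, hA, hAx⟩ := hq t ht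
    have h1 : ∑ k, (q t u k - q t v k) ^ 2 = ∑ k, (p u k - p v k) ^ 2 := by
      rw [← sum_sq_mulVec hA (fun k => p u k - p v k)]
      refine Finset.sum_congr rfl fun k _ => ?_
      have h2 : (fun k => p u k - p v k) = p u - p v := rfl
      rw [hAx, hAx, h2, Matrix.mulVec_sub]
      simp
    have h2 : ∀ k, (q t u k - q t v k) ^ 2 = (p u k - p v k) ^ 2 +
        if k = o then 2 * t * (p u o - p v o) + t ^ 2 else 0 := by
      intro k
      have hu : G.Reachable u u := SimpleGraph.Reachable.refl u
      simp only [q, huv, hu, true_and, false_and, if_false]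
      split_ifs with hk
      · subst hk; ring
      · ring
    simp only [h2, Finset.sum_add_distrib] at h1
    simpa using h1
  have h1 := hdist 1 (by simp)
  have h2 := hdist (1 / 2) (by constructor <;> norm_num)
  linarith

section
open Matrix
variable {F : Type*} [Field F]

/-- Cholesky decomposition over an algebraically closed field. -/
theorem exists_cholesky [IsAlgClosed F] (d : ℕ) (M : Matrix (Fin d) (Fin d) F) (hM : Mᵀ = M)
    (hdet : ∀ (k : ℕ) (hk : k ≤ d), (M.submatrix (Fin.castLE hk) (Fin.castLE hk)).det ≠ 0) :
    ∃ R : Matrix (Fin d) (Fin d) F, R.IsUpperTriangular ∧ Rᵀ * R = M ∧ R.det ≠ 0 := by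
  induction d with
  | zero => exact ⟨1, blockTriangular_one, Subsingleton.elim _ _, by simp⟩
  | succ d ih =>
    obtain ⟨R, hR, hRM, hRd⟩ := ih (M.submatrix Fin.castSucc Fin.castSucc)
      (by rw [transpose_submatrix, hM]) (fun k hk => by
        have := hdet k (by omega)
        rw [submatrix_submatrix]
        exact this)
    have hRu : IsUnit (Rᵀ).det := by rw [det_transpose]; exact hRd.isUnit
    let b : Fin d → F := fun i => M i.castSucc (Fin.last d)
    let r : Fin d → F := (Rᵀ)⁻¹ *ᵥ b
    have hr : Rᵀ *ᵥ r = b := by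
      simp only [r, mulVec_mulVec, mul_nonsing_inv _ hRu, one_mulVec]
    obtain ⟨s, hs⟩ := IsAlgClosed.exists_pow_nat_eq
      (M (Fin.last d) (Fin.last d) - ∑ i, r i * r i) (n := 2) (by norm_num)
    let R' : Matrix (Fin (d + 1)) (Fin (d + 1)) F :=
      of fun i j => Fin.lastCases (Fin.lastCases s (fun _ => 0) j)
        (fun i => Fin.lastCases (r i) (fun j => R i j) j) i
    have h00 : ∀ i j : Fin d, R' i.castSucc j.castSucc = R i j := fun i j => by simp [R']
    have h01 : ∀ i : Fin d, R' i.castSucc (Fin.last d) = r i := fun i => by simp [R']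
    have h10 : ∀ j : Fin d, R' (Fin.last d) j.castSucc = 0 := fun i => by simp [R']
    have h11 : R' (Fin.last d) (Fin.last d) = s := by simp [R']
    have hprod : R'ᵀ * R' = M := by
      have hr' : ∀ j, ∑ i, R i j * r i = M j.castSucc (Fin.last d) := fun j => congrFun hr j
      have hsymm : ∀ i j, M i j = M j i := fun i j => congrFun (congrFun hM.symm i) j
      ext i j
      rw [mul_apply, Fin.sum_univ_castSucc]
      simp only [transpose_apply]
      induction i using Fin.lastCases with
      | last =>
        induction j using Fin.lastCases with
        | last =>
          simp only [h01, h11, ← sq] at hs ⊢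
          rw [hs]; ring
        | cast j =>
          simp only [h01, h11, h00, h10, mul_zero, add_zero]
          rw [hsymm, ← hr' j]
          exact Finset.sum_congr rfl fun i _ => mul_comm _ _
      | cast i =>
        induction j using Fin.lastCases with
        | last =>
          simp only [h01, h11, h00, h10, zero_mul, add_zero]
          exact hr' i
        | cast j =>
          simp only [h00, h10, mul_zero, add_zero]
          exact congrFun (congrFun hRM i) j
    refine ⟨R', ?_, hprod, ?_⟩
    · intro i j hij
      induction i using Fin.lastCases with
      | last =>
        induction j using Fin.lastCases with
        | last => exact absurd hij (lt_irrefl _)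
        | cast j => exact h10 j
      | cast i =>
        induction j using Fin.lastCases with
        | last => exact absurd hij (not_lt.mpr (Fin.le_last _))
        | cast j =>
          rw [h00]
          exact hR (by simpa using hij)
    · intro h
      have h1 := hdet (d + 1) le_rfl
      apply h1
      have h2 : M.submatrix (Fin.castLE le_rfl) (Fin.castLE le_rfl) = M := by ext; rfl
      rw [h2, ← hprod, det_mul, h, mul_zero]

theorem exists_qr [IsAlgClosed F] {d : ℕ} (U : Matrix (Fin d) (Fin d) F)
    (hdet : ∀ (k : ℕ) (hk : k ≤ d), ((Uᵀ * U).submatrix (Fin.castLE hk) (Fin.castLE hk)).det ≠ 0) :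
    ∃ O R : Matrix (Fin d) (Fin d) F, Oᵀ * O = 1 ∧ R.IsUpperTriangular ∧ R.det ≠ 0 ∧ U = O * R := by
  obtain ⟨R, hR, hRM, hRd⟩ := exists_cholesky d (Uᵀ * U) (by simp) hdet
  have hu : IsUnit R.det := hRd.isUnit
  have hut : IsUnit (Rᵀ).det := by rw [det_transpose]; exact hu
  refine ⟨U * R⁻¹, R, ?_, hR, hRd, ?_⟩
  · rw [transpose_mul, transpose_nonsing_inv]
    calc (Rᵀ)⁻¹ * Uᵀ * (U * R⁻¹) = (Rᵀ)⁻¹ * (Uᵀ * U) * R⁻¹ := by simp only [Matrix.mul_assoc]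
      _ = ((Rᵀ)⁻¹ * Rᵀ) * (R * R⁻¹) := by rw [← hRM]; simp only [Matrix.mul_assoc]
      _ = 1 := by rw [nonsing_inv_mul _ hut, mul_nonsing_inv _ hu, one_mul]
  · rw [Matrix.mul_assoc, nonsing_inv_mul _ hu, Matrix.mul_one]

theorem eq_diagonal_of_upperTriangular_orthogonal {d : ℕ} {Z : Matrix (Fin d) (Fin d) F}
    (hZ : Z.IsUpperTriangular) (h : Zᵀ * Z = 1) :
    ∃ ε : Fin d → ℤˣ, Z = diagonal fun i => ((ε i : ℤ) : F) := by
  have hinv : Z⁻¹ = Zᵀ := inv_eq_left_inv h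
  have : Invertible Z := invertibleOfLeftInverse _ _ h
  have hlow : Zᵀ.IsUpperTriangular := hinv ▸ blockTriangular_inv_of_blockTriangular hZ
  have hdiag : Z = diagonal fun i => Z i i := by
    ext i j
    rcases lt_trichotomy i j with hij | rfl | hij
    · rw [diagonal_apply_ne _ hij.ne]; exact hlow hij
    · simp
    · rw [diagonal_apply_ne _ hij.ne']; exact hZ hij
  have hsq : ∀ i, Z i i = 1 ∨ Z i i = -1 := by
    intro i
    rw [hdiag, diagonal_transpose, diagonal_mul_diagonal] at h
    have := congrFun (congrFun h i) i
    rw [diagonal_apply_eq, one_apply_eq] at this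
    exact mul_self_eq_one_iff.mp this
  have : ∀ i, ∃ ε : ℤˣ, Z i i = ((ε : ℤ) : F) := fun i => by
    rcases hsq i with h | h
    · exact ⟨1, by simp [h]⟩
    · exact ⟨-1, by simp [h]⟩
  choose ε hε using this
  refine ⟨ε, ?_⟩
  rw [hdiag]
  congr 1
  ext i
  exact hε i

/-- The orthogonal matrices `A` bringing the columns of `U` in the position prescribed by the
rows of `Γ`. -/
def pinnedOrthogonal {d : ℕ} (Γ U : Matrix (Fin d) (Fin d) F) : Set (Matrix (Fin d) (Fin d) F) :=
  {A | Aᵀ * A = 1 ∧ ∀ l j : Fin d, l.val + j.val + 1 < d → (Γ * A * U) l j = 0}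

theorem ncard_pinnedOrthogonal [CharZero F] [IsAlgClosed F] {d : ℕ} (Γ U : Matrix (Fin d) (Fin d) F)
    (hΓ : ∀ (k : ℕ) (hk : k ≤ d), ((Γ * Γᵀ).submatrix (Fin.castLE hk) (Fin.castLE hk)).det ≠ 0)
    (hU : ∀ (k : ℕ) (hk : k ≤ d), ((Uᵀ * U).submatrix (Fin.castLE hk) (Fin.castLE hk)).det ≠ 0) :
    (pinnedOrthogonal Γ U).ncard = 2 ^ d := by
  obtain ⟨O, R, hO, hR, hRd, rfl⟩ := exists_qr U hU
  obtain ⟨P, S, hP, hS, hSd, hΓ'⟩ := exists_qr Γᵀ (by simpa using hΓ)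
  have hΓ'' : Γ = Sᵀ * Pᵀ := by rw [← transpose_mul, ← hΓ', transpose_transpose]
  subst hΓ''
  have hO' : O * Oᵀ = 1 := mul_eq_one_comm.mp hO
  have hP' : P * Pᵀ = 1 := mul_eq_one_comm.mp hP
  let T : Matrix (Fin d) (Fin d) F := Sᵀ.submatrix Fin.rev Fin.rev
  have hT : T.IsUpperTriangular := fun i j hij => hS (Fin.rev_lt_rev.mpr hij)
  have hTd : T.det ≠ 0 := by
    rw [show T = Sᵀ.submatrix Fin.revPerm Fin.revPerm from rfl, det_submatrix_equiv_self,
      det_transpose]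
    exact hSd
  let Φ : Matrix (Fin d) (Fin d) F → Matrix (Fin d) (Fin d) F := fun Z =>
    P * Z.submatrix Fin.rev id * Oᵀ
  have hsub : ∀ A B C : Matrix (Fin d) (Fin d) F,
      (A * B * C).submatrix Fin.rev id =
        A.submatrix Fin.rev Fin.rev * B.submatrix Fin.rev id * C := by
    intro A B C
    rw [show A.submatrix Fin.rev Fin.rev = A.submatrix Fin.rev Fin.revPerm from rfl,
      show B.submatrix Fin.rev id = B.submatrix Fin.revPerm id from rfl,
      submatrix_mul_equiv]
    rfl
  have hss : ∀ A : Matrix (Fin d) (Fin d) F, (A.submatrix Fin.rev id).submatrix Fin.rev id = A := by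
    intro A; ext i j; simp
  have horth : ∀ Z : Matrix (Fin d) (Fin d) F,
      (Z.submatrix Fin.rev id)ᵀ * Z.submatrix Fin.rev id = Zᵀ * Z := by
    intro Z
    rw [transpose_submatrix, show Z.submatrix Fin.rev id = Z.submatrix Fin.revPerm id from rfl,
      show Zᵀ.submatrix id Fin.rev = Zᵀ.submatrix id Fin.revPerm from rfl, submatrix_mul_equiv]
    simp
  have hΦorth : ∀ Z, (Φ Z)ᵀ * Φ Z = O * (Zᵀ * Z) * Oᵀ := by
    intro Z
    rw [← horth Z]
    simp only [Φ, transpose_mul, transpose_transpose]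
    calc _ = O * (Z.submatrix Fin.rev id)ᵀ * (Pᵀ * P) * Z.submatrix Fin.rev id * Oᵀ := by
            simp only [Matrix.mul_assoc]
      _ = _ := by rw [hP]; simp only [Matrix.mul_assoc, Matrix.one_mul]
  have hΦinj : Function.Injective Φ := by
    intro Z Z' h
    have h1 : Pᵀ * Φ Z * O = Pᵀ * Φ Z' * O := by rw [h]
    have h2 : ∀ Z, Pᵀ * Φ Z * O = Z.submatrix Fin.rev id := fun Z => by
      calc Pᵀ * Φ Z * O = (Pᵀ * P) * Z.submatrix Fin.rev id * (Oᵀ * O) := by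
            simp only [Φ, Matrix.mul_assoc]
        _ = _ := by rw [hP, hO, Matrix.one_mul, Matrix.mul_one]
    rw [h2, h2] at h1
    rw [← hss Z, h1, hss]
  have hΦtri : ∀ Z, (Sᵀ * Pᵀ * Φ Z * (O * R)).submatrix Fin.rev id = T * Z * R := by
    intro Z
    have : Sᵀ * Pᵀ * Φ Z * (O * R) = Sᵀ * Z.submatrix Fin.rev id * R := by
      calc _ = Sᵀ * (Pᵀ * P) * Z.submatrix Fin.rev id * (Oᵀ * O) * R := by
            simp only [Φ, Matrix.mul_assoc]
        _ = _ := by rw [hP, hO, Matrix.mul_one, Matrix.mul_one]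
    rw [this, hsub, hss]
  have hcond : ∀ M : Matrix (Fin d) (Fin d) F, (∀ l j : Fin d, l.val + j.val + 1 < d → M l j = 0) ↔
      (M.submatrix Fin.rev id).IsUpperTriangular := by
    intro M
    constructor
    · intro h i j hij
      apply h
      have : j.val < i.val := hij
      simp only [Fin.val_rev, id]
      omega
    · intro h l j hlj
      have := h (i := l.rev) (j := j) (by
        change j.val < (l.rev).val
        rw [Fin.val_rev]; omega)
      simpa using this
  have hset : pinnedOrthogonal (Sᵀ * Pᵀ) (O * R) =
      Φ '' Set.range fun ε : Fin d → ℤˣ => diagonal fun i => ((ε i : ℤ) : F) := by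
    ext A
    constructor
    · rintro ⟨h1, h2⟩
      let Z := (Pᵀ * A * O).submatrix Fin.rev id
      have hA : Φ Z = A := by
        simp only [Φ, Z, hss]
        calc _ = (P * Pᵀ) * A * (O * Oᵀ) := by simp only [Matrix.mul_assoc]
          _ = A := by rw [hP', hO', Matrix.one_mul, Matrix.mul_one]
      rw [hcond, ← hA, hΦtri] at h2
      have hZo : Zᵀ * Z = 1 := by
        have := hΦorth Z
        rw [hA, h1] at this
        calc Zᵀ * Z = (Oᵀ * O) * (Zᵀ * Z) * (Oᵀ * O) := by
              rw [hO, Matrix.one_mul, Matrix.mul_one]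
          _ = Oᵀ * (O * (Zᵀ * Z) * Oᵀ) * O := by simp only [Matrix.mul_assoc]
          _ = 1 := by rw [← this, Matrix.mul_one, hO]
      have hTu : IsUnit T.det := hTd.isUnit
      have hRu : IsUnit R.det := hRd.isUnit
      have : Invertible T := invertibleOfIsUnitDet _ hTu
      have : Invertible R := invertibleOfIsUnitDet _ hRu
      have hZt : Z.IsUpperTriangular := by
        have h3 : Z = T⁻¹ * (T * Z * R) * R⁻¹ := by
          calc Z = (T⁻¹ * T) * Z * (R * R⁻¹) := by
                rw [nonsing_inv_mul _ hTu, mul_nonsing_inv _ hRu, Matrix.one_mul, Matrix.mul_one]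
            _ = _ := by simp only [Matrix.mul_assoc]
        rw [h3]
        exact ((blockTriangular_inv_of_blockTriangular hT).mul h2).mul
          (blockTriangular_inv_of_blockTriangular hR)
      obtain ⟨ε, hε⟩ := eq_diagonal_of_upperTriangular_orthogonal hZt hZo
      exact ⟨Z, ⟨ε, hε.symm⟩, hA⟩
    · rintro ⟨_, ⟨ε, rfl⟩, rfl⟩
      refine ⟨?_, ?_⟩
      · rw [hΦorth, diagonal_transpose, diagonal_mul_diagonal]
        have : (fun i => (((ε i : ℤ) : F) * ((ε i : ℤ) : F))) = fun _ => 1 := by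
          ext i
          rcases Int.units_eq_one_or (ε i) with h | h <;> simp [h]
        rw [this, diagonal_one, Matrix.mul_one, hO']
      · rw [hcond, hΦtri]
        exact (hT.mul (blockTriangular_diagonal _)).mul hR
  have hinj : Function.Injective fun ε : Fin d → ℤˣ => diagonal fun i => ((ε i : ℤ) : F) := by
    intro ε ε' h
    have h1 := diagonal_injective h
    ext i
    exact Int.cast_injective (congrFun h1 i)
  rw [hset, Set.ncard_image_of_injective _ hΦinj, ← Nat.card_coe_set_eq,
    Nat.card_range_of_injective hinj]
  simp

end

section Transfer
open Cardinal

/-- Algebraically closed fields with equipotent transcendence bases over a ring are isomorphic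
over that ring. -/
theorem nonempty_algEquiv_of_isTranscendenceBasis {R K L ι κ : Type*}
    [CommRing R] [Field K] [Field L]
    [Algebra R K] [Algebra R L] [IsAlgClosed K] [IsAlgClosed L] {v : ι → K} {w : κ → L} (e : ι ≃ κ)
    (hv : IsTranscendenceBasis R v) (hw : IsTranscendenceBasis R w) : Nonempty (K ≃ₐ[R] L) := by
  let _ := IsAlgClosed.isAlgClosure_of_transcendence_basis v hv
  let _ := IsAlgClosed.isAlgClosure_of_transcendence_basis w hw
  let f : Algebra.adjoin R (Set.range v) ≃ₐ[R] Algebra.adjoin R (Set.range w) :=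
    (hv.1.aevalEquiv.symm.trans (MvPolynomial.renameEquiv R e)).trans hw.1.aevalEquiv
  refine ⟨AlgEquiv.ofRingEquiv (f := IsAlgClosure.equivOfEquiv K L f.toRingEquiv) fun r => ?_⟩
  rw [IsScalarTower.algebraMap_apply R (Algebra.adjoin R (Set.range v)) K,
    IsAlgClosure.equivOfEquiv_algebraMap,
    IsScalarTower.algebraMap_apply R (Algebra.adjoin R (Set.range w)) L]
  exact congrArg _ (f.commutes r)

/-- Uncountable algebraically closed fields of the same cardinality are isomorphic over any
countable common subring. -/
theorem nonempty_algEquiv_of_countable {R : Type*} {K L : Type*} [CommRing R] [Countable R]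
    [Field K] [Field L] [Algebra R K] [Algebra R L] [FaithfulSMul R K] [FaithfulSMul R L]
    [IsAlgClosed K] [IsAlgClosed L] [hK : Uncountable K] (e : K ≃ L) : Nonempty (K ≃ₐ[R] L) := by
  have hL : Uncountable L := e.injective.uncountable
  have : Nontrivial R := (algebraMap R K).domain_nontrivial
  obtain ⟨s, hs⟩ := exists_isTranscendenceBasis R K
  obtain ⟨t, ht⟩ := exists_isTranscendenceBasis R L
  have h1 := IsAlgClosed.cardinal_eq_cardinal_transcendence_basis_of_aleph0_lt _ hs mk_le_aleph0
    (aleph0_lt_mk_iff.mpr hK)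
  have h2 := IsAlgClosed.cardinal_eq_cardinal_transcendence_basis_of_aleph0_lt _ ht mk_le_aleph0
    (aleph0_lt_mk_iff.mpr hL)
  rw [lift_inj] at h1 h2
  obtain ⟨g⟩ : Nonempty (s ≃ t) := by
    rw [← lift_mk_eq', ← h1, ← h2]
    exact lift_mk_eq'.mpr ⟨e⟩
  exact nonempty_algEquiv_of_isTranscendenceBasis g hs ht

/-- Algebraically independent elements can be moved to complex numbers at which a given polynomial
does not vanish. -/
theorem exists_ringEquiv_eval_ne_zero {σ Ω : Type*} [Field Ω] [IsAlgClosed Ω] [Algebra ℂ Ω]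
    (e : Ω ≃ ℂ) {x : σ → Ω} (hx : AlgebraicIndependent ℂ x) {f : MvPolynomial σ ℂ} (hf : f ≠ 0) :
    ∃ ρ : Ω ≃+* ℂ, MvPolynomial.eval (fun v => ρ (x v)) f ≠ 0 := by
  let R := Algebra.adjoin ℤ (f.coeffs : Set ℂ)
  have : Countable R := by
    rw [← mk_le_aleph0_iff]
    have := Algebra.lift_cardinalMk_adjoin_le ℤ (f.coeffs : Set ℂ)
    rw [lift_id] at this
    refine this.trans ?_
    simp
  have : FaithfulSMul R ℂ := (faithfulSMul_iff_algebraMap_injective R ℂ).mpr Subtype.val_injective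
  have hRΩ : Function.Injective (algebraMap R Ω) :=
    (algebraMap ℂ Ω).injective.comp Subtype.val_injective
  have : FaithfulSMul R Ω := (faithfulSMul_iff_algebraMap_injective R Ω).mpr hRΩ
  have : Uncountable ℂ := aleph0_lt_mk_iff.mp (mk_complex ▸ aleph0_lt_continuum)
  have : Uncountable Ω := (algebraMap ℂ Ω).injective.uncountable
  obtain ⟨ρ⟩ := nonempty_algEquiv_of_countable (R := R) e
  obtain ⟨g, hg⟩ : f ∈ (MvPolynomial.map (σ := σ) (algebraMap R ℂ)).range := by
    refine MvPolynomial.mem_range_map_iff_coeffs_subset.mpr ?_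
    intro a ha
    exact ⟨⟨a, Algebra.subset_adjoin ha⟩, rfl⟩
  refine ⟨ρ.toRingEquiv, fun h => hf ?_⟩
  have h1 : ρ (MvPolynomial.aeval x g) = 0 := by
    rw [← h, ← hg, MvPolynomial.eval_map, ← MvPolynomial.aeval_def, ← AlgEquiv.coe_toAlgHom,
      ← AlgHom.comp_apply, MvPolynomial.comp_aeval]
    rfl
  rw [map_eq_zero_iff _ ρ.injective] at h1
  apply hx
  rw [← hg, map_zero, MvPolynomial.aeval_map_algebraMap, h1]

end Transfer

section
open MvPolynomial

theorem nonempty_equiv_complex (P : Type) [Finite P] :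
    Nonempty (AlgebraicClosure (RatFuncField P) ≃ ℂ) := by
  rw [← Cardinal.eq]
  apply le_antisymm
  · refine (Algebra.IsAlgebraic.cardinalMk_le_max (RatFuncField P) _).trans ?_
    rw [Cardinal.mk_fractionRing]
    refine max_le (cardinalMk_le_max.trans ?_) ?_
    · have h : Cardinal.mk P ≤ Cardinal.aleph0 := Cardinal.mk_le_aleph0
      rw [Cardinal.mk_complex]
      exact max_le (max_le le_rfl (h.trans Cardinal.aleph0_le_continuum))
        Cardinal.aleph0_le_continuum
    · rw [Cardinal.mk_complex]
      exact Cardinal.aleph0_le_continuum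
  · exact Cardinal.mk_le_of_injective (algebraMap ℂ (AlgebraicClosure (RatFuncField P))).injective

/-- An algebraically closed field containing generic points `x` and `γ`, and in which the
parameters are specialised to the edge lengths of `x` and to entries of `γ`. -/
theorem exists_generic_point {n d : ℕ} {G : SimpleGraph (Fin n)} {P P' : Type} [Finite P']
    (hG : IsMinimallyRigidGraph G d)
    {ι : P → P'} (hι : Function.Injective ι) :
    ∃ (Ω : Type) (_ : Field Ω) (_ : IsAlgClosed Ω) (_ : Algebra ℂ Ω)
      (_ : Algebra (RatFuncField (G.edgeSet ⊕ P)) Ω)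
      (_ : IsScalarTower ℂ (RatFuncField (G.edgeSet ⊕ P)) Ω) (x : Fin n × Fin d → Ω) (γ : P' → Ω),
      Nonempty (Ω ≃ ℂ) ∧ AlgebraicIndependent ℂ (Sum.elim x γ) ∧
      (∀ e : G.edgeSet, algebraMap (RatFuncField (G.edgeSet ⊕ P)) Ω (ratParam (Sum.inl e)) =
        aeval x (sqLen ℂ d (e : Sym2 (Fin n)))) ∧
      ∀ c : P, algebraMap (RatFuncField (G.edgeSet ⊕ P)) Ω (ratParam (Sum.inr c)) = γ (ι c) := by
  let Ω := AlgebraicClosure (RatFuncField ((Fin n × Fin d) ⊕ P'))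
  let g : MvPolynomial ((Fin n × Fin d) ⊕ P') ℂ →ₐ[ℂ] Ω :=
    IsScalarTower.toAlgHom ℂ (MvPolynomial ((Fin n × Fin d) ⊕ P') ℂ) Ω
  have hg : Function.Injective g :=
    (algebraMap (RatFuncField ((Fin n × Fin d) ⊕ P')) Ω).injective.comp
      (IsFractionRing.injective (MvPolynomial ((Fin n × Fin d) ⊕ P') ℂ) _)
  let z : (Fin n × Fin d) ⊕ P' → Ω := fun v => g (X v)
  have hz : aeval z = g := by
    apply MvPolynomial.algHom_ext
    intro v
    rw [aeval_X]
  have hinj := hg.comp (edge_param_injective hG ι hι)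
  rw [← AlgHom.coe_comp] at hinj
  let φ : RatFuncField (G.edgeSet ⊕ P) →ₐ[ℂ] Ω := IsFractionRing.liftAlgHom hinj
  have hφ : ∀ p, φ (ratParam p) = g (Sum.elim
      (fun e : G.edgeSet =>
        rename (Sum.inl : _ → (Fin n × Fin d) ⊕ P') (sqLen ℂ d (e : Sym2 (Fin n))))
      (fun c : P => X (Sum.inr (ι c))) p) := fun p => by
    have h1 := IsFractionRing.lift_algebraMap (K := RatFuncField (G.edgeSet ⊕ P)) hinj (X p)
    refine h1.trans ?_
    change g (aeval _ (X p)) = _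
    rw [aeval_X]
  let _ : Algebra (RatFuncField (G.edgeSet ⊕ P)) Ω := φ.toRingHom.toAlgebra
  refine ⟨Ω, inferInstance, inferInstance, inferInstance, φ.toRingHom.toAlgebra,
    IsScalarTower.of_algebraMap_eq fun r => (φ.commutes r).symm, z ∘ Sum.inl, z ∘ Sum.inr,
    nonempty_equiv_complex _, ?_, fun e => ?_, fun c => ?_⟩
  · rw [Sum.elim_comp_inl_inr, algebraicIndependent_iff_injective_aeval, hz]
    exact hg
  · refine (hφ _).trans ?_
    rw [← aeval_rename, hz]
    rfl
  · exact hφ _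

end

section Fibre
open Matrix

/-- Congruence of realisations over an arbitrary field. -/
def congSetoid (F : Type*) [Field F] (n d : ℕ) : Setoid (Fin n → Fin d → F) where
  r p q := ∃ (A : Matrix (Fin d) (Fin d) F) (x : Fin d → F), Aᵀ * A = 1 ∧ ∀ i, p i = A *ᵥ q i + x
  iseqv :=
    { refl := fun p => ⟨1, 0, by simp, by simp⟩
      symm := fun {p q} ⟨A, x, hA, h⟩ =>
        ⟨Aᵀ, -(Aᵀ *ᵥ x), by rw [transpose_transpose, mul_eq_one_comm.mp hA], fun i => by
          rw [h, mulVec_add, mulVec_mulVec, hA, one_mulVec, add_neg_cancel_right]⟩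
      trans := fun {p q r} ⟨A, x, hA, h⟩ ⟨B, y, hB, h'⟩ =>
        ⟨A * B, A *ᵥ y + x, by
          rw [transpose_mul, Matrix.mul_assoc, ← Matrix.mul_assoc Aᵀ, hA, Matrix.one_mul, hB],
          fun i => by rw [h, h', mulVec_add, mulVec_mulVec, add_assoc]⟩ }

theorem congruent_iff {n d : ℕ} (p q : Fin n → Fin d → ℂ) : Congruent p q ↔ congSetoid ℂ n d p q :=
  ⟨fun ⟨A, x, _, hA, h⟩ => ⟨A, x, hA, h⟩,
    fun ⟨A, x, hA, h⟩ => ⟨A, x, mul_eq_one_comm.mp hA, hA, h⟩⟩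

/-- The realisations with the same edge lengths as `p`. -/
def lengthFibre {F : Type*} [Field F] {n d : ℕ} (G : SimpleGraph (Fin n)) (p : Fin n → Fin d → F) :
    Set (Fin n → Fin d → F) :=
  {q | ∀ i j, G.Adj i j → ∑ k, (q i k - q j k) ^ 2 = ∑ k, (p i k - p j k) ^ 2}

theorem setOf_rigidityMap_eq {n d : ℕ} (G : SimpleGraph (Fin n)) (p : Fin n → Fin d → ℂ) :
    {q | rigidityMap G d q = rigidityMap G d p} = lengthFibre G p := by
  ext q
  constructor
  · intro h i j hij
    exact mul_left_cancel₀ (inv_ne_zero two_ne_zero) (congrFun h ⟨s(i, j), hij⟩)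
  · intro h
    ext ⟨e, he⟩
    induction e using Sym2.ind with
    | _ i j => exact congrArg (2⁻¹ * ·) (h i j he)

theorem ncard_image_class {α : Type*} (r : Setoid α) (S : Set α) :
    ((fun q => {q' ∈ S | r q q'}) '' S).ncard = (Quotient.mk r '' S).ncard := by
  let g : Quotient r → Set α := Quotient.lift (fun q => {q' ∈ S | r q q'}) fun a b hab => by
    ext q
    exact and_congr_right fun _ => ⟨r.trans (r.symm hab), r.trans hab⟩
  have h : (fun q => {q' ∈ S | r q q'}) '' S = g '' (Quotient.mk r '' S) := by
    rw [Set.image_image]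
    rfl
  rw [h, Set.InjOn.ncard_image]
  rintro _ ⟨a, ha, rfl⟩ _ ⟨b, hb, rfl⟩ hab
  have h1 : b ∈ {q' ∈ S | r a q'} := (show {q' ∈ S | r a q'} = {q' ∈ S | r b q'} from hab) ▸
    ⟨hb, r.refl b⟩
  exact Quotient.sound h1.2

theorem ncard_congClasses {n d : ℕ} (S : Set (Fin n → Fin d → ℂ)) :
    (congClasses S).ncard = (Quotient.mk (congSetoid ℂ n d) '' S).ncard := by
  rw [← ncard_image_class]
  simp only [congClasses, congruent_iff]

theorem congSetoid_map {K L : Type*} [Field K] [Field L] (τ : K →+* L) {n d : ℕ}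
    {p q : Fin n → Fin d → K} (h : congSetoid K n d p q) :
    congSetoid L n d (fun i k => τ (p i k)) (fun i k => τ (q i k)) := by
  obtain ⟨A, x, hA, h⟩ := h
  refine ⟨A.map τ, fun k => τ (x k), ?_, fun i => ?_⟩
  · rw [← transpose_map, ← Matrix.map_mul, hA, Matrix.map_one _ (map_zero τ) (map_one τ)]
  · ext k
    change τ (p i k) = _
    rw [congrFun (h i) k, Pi.add_apply, Pi.add_apply, map_add, RingHom.map_mulVec]
    rfl

theorem ncard_classes_map {F F' : Type*} [Field F] [Field F'] (ρ : F ≃+* F') {n d : ℕ}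
    (G : SimpleGraph (Fin n)) (p : Fin n → Fin d → F) :
    (Quotient.mk (congSetoid F n d) '' lengthFibre G p).ncard =
      (Quotient.mk (congSetoid F' n d) '' lengthFibre G fun i k => ρ (p i k)).ncard := by
  let e : (Fin n → Fin d → F) ≃ (Fin n → Fin d → F') :=
    Equiv.piCongrRight fun _ => Equiv.piCongrRight fun _ => ρ.toEquiv
  have he : ∀ p q, congSetoid F n d p q ↔ congSetoid F' n d (e p) (e q) := fun p q =>
    ⟨congSetoid_map ρ.toRingHom, fun h => by
      simpa [e] using congSetoid_map ρ.symm.toRingHom h⟩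
  have himg : lengthFibre G (e p) = e '' lengthFibre G p := by
    rw [Equiv.image_eq_preimage_symm]
    ext q
    obtain ⟨q, rfl⟩ := e.surjective q
    rw [Set.mem_preimage, Equiv.symm_apply_apply]
    refine forall₃_congr fun i j _ => ?_
    rw [← ρ.injective.eq_iff]
    simp [e]
  change _ = (Quotient.mk (congSetoid F' n d) '' lengthFibre G (e p)).ncard
  rw [himg, ← Set.ncard_image_of_injective _ (Quotient.congr e he).injective, Set.image_image,
    Set.image_image]
  rfl

theorem ncard_classes_generic {Ω : Type*} [Field Ω] [IsAlgClosed Ω] [Algebra ℂ Ω]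
    (e : Ω ≃ ℂ) {n d c : ℕ} {G : SimpleGraph (Fin n)} (hc : IsRealisationNumber G d c)
    {x : Fin n × Fin d → Ω} (hx : AlgebraicIndependent ℂ x) :
    (Quotient.mk (congSetoid Ω n d) '' lengthFibre G fun i k => x (i, k)).ncard = c := by
  obtain ⟨-, f, hf, h⟩ := hc
  obtain ⟨ρ, hρ⟩ := exists_ringEquiv_eval_ne_zero e hx hf
  rw [ncard_classes_map ρ, ← h (fun i k => ρ (x (i, k))) hρ, ncard_congClasses,
    setOf_rigidityMap_eq]

end Fibre

section Minors
open Matrix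

/-- The product of the leading principal minors of the Gram matrix of the columns of `U`. -/
def gramMinors {R : Type*} [CommRing R] {d : ℕ} (U : Matrix (Fin d) (Fin d) R) : R :=
  ∏ k : Fin (d + 1), ((Uᵀ * U).submatrix (Fin.castLE (Nat.le_of_lt_succ k.isLt))
    (Fin.castLE (Nat.le_of_lt_succ k.isLt))).det

theorem map_gramMinors {R S : Type*} [CommRing R] [CommRing S] (τ : R →+* S) {d : ℕ}
    (U : Matrix (Fin d) (Fin d) R) : τ (gramMinors U) = gramMinors (U.map τ) := by
  simp only [gramMinors, map_prod, RingHom.map_det, RingHom.mapMatrix_apply, ← submatrix_map,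
    Matrix.map_mul, transpose_map]

theorem gramMinors_one {R : Type*} [CommRing R] {d : ℕ} :
    gramMinors (1 : Matrix (Fin d) (Fin d) R) = 1 := by
  refine Finset.prod_eq_one fun k _ => ?_
  rw [transpose_one, Matrix.one_mul, submatrix_one _ (Fin.castLE_injective _), det_one]

theorem gramMinors_orthogonal_mul {R : Type*} [CommRing R] {d : ℕ} {A : Matrix (Fin d) (Fin d) R}
    (hA : Aᵀ * A = 1) (U : Matrix (Fin d) (Fin d) R) : gramMinors (A * U) = gramMinors U := by
  have : (A * U)ᵀ * (A * U) = Uᵀ * U := by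
    rw [transpose_mul, Matrix.mul_assoc, ← Matrix.mul_assoc Aᵀ, hA, Matrix.one_mul]
  simp only [gramMinors, this]

theorem det_ne_zero_of_gramMinors {F : Type*} [Field F] {d : ℕ} {U : Matrix (Fin d) (Fin d) F}
    (h : gramMinors U ≠ 0) (k : ℕ) (hk : k ≤ d) :
    ((Uᵀ * U).submatrix (Fin.castLE hk) (Fin.castLE hk)).det ≠ 0 :=
  (Finset.prod_ne_zero_iff.mp h) ⟨k, Nat.lt_succ_of_le hk⟩ (Finset.mem_univ _)

theorem isUnit_det_of_gramMinors {F : Type*} [Field F] {d : ℕ} {U : Matrix (Fin d) (Fin d) F}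
    (h : gramMinors U ≠ 0) : IsUnit U.det := by
  rw [isUnit_iff_ne_zero]
  intro h0
  refine det_ne_zero_of_gramMinors h d le_rfl ?_
  have : (Uᵀ * U).submatrix (Fin.castLE le_rfl) (Fin.castLE le_rfl) = Uᵀ * U := by ext; rfl
  rw [this, det_mul, h0, mul_zero]

/-- The positions of the vertices `1, …, d` relative to the vertex `0`, as columns. -/
def relMatrix {R : Type*} [CommRing R] {n d : ℕ} [NeZero n] (hn : d + 1 ≤ n)
    (q : Fin n → Fin d → R) : Matrix (Fin d) (Fin d) R :=
  of fun k j => q (Fin.castLE hn j.succ) k - q 0 k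

theorem relMatrix_map {R S : Type*} [CommRing R] [CommRing S] (τ : R →+* S) {n d : ℕ} [NeZero n]
    (hn : d + 1 ≤ n) (q : Fin n → Fin d → R) :
    (relMatrix hn q).map τ = relMatrix hn fun i k => τ (q i k) := by
  ext k j
  simp [relMatrix]

theorem relMatrix_mulVec_add {R : Type*} [CommRing R] {n d : ℕ} [NeZero n] (hn : d + 1 ≤ n)
    (q : Fin n → Fin d → R) (A : Matrix (Fin d) (Fin d) R) (x : Fin d → R) :
    relMatrix hn (fun i => A *ᵥ q i + x) = A * relMatrix hn q := by
  ext k j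
  simp [relMatrix, mul_apply, mulVec, dotProduct, mul_sub]

theorem gramMinors_relMatrix_congr {F : Type*} [Field F] {n d : ℕ} [NeZero n] (hn : d + 1 ≤ n)
    {p q : Fin n → Fin d → F} (h : congSetoid F n d p q) :
    gramMinors (relMatrix hn p) = gramMinors (relMatrix hn q) := by
  obtain ⟨A, x, hA, h⟩ := h
  rw [show p = fun i => A *ᵥ q i + x from funext h, relMatrix_mulVec_add,
    gramMinors_orthogonal_mul hA]

/-- The polynomial `gramMinors` of the relative positions in a realisation. -/
def relMinors {n d : ℕ} [NeZero n] (hn : d + 1 ≤ n) : MvPolynomial (Fin n × Fin d) ℂ :=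
  gramMinors (relMatrix hn fun i k => MvPolynomial.X (i, k))

theorem aeval_relMinors {S : Type*} [CommRing S] [Algebra ℂ S] {n d : ℕ} [NeZero n]
    (hn : d + 1 ≤ n) (η : Fin n × Fin d → S) :
    MvPolynomial.aeval η (relMinors hn) = gramMinors (relMatrix hn fun i k => η (i, k)) := by
  rw [relMinors, ← AlgHom.coe_toRingHom, map_gramMinors, relMatrix_map]
  simp

theorem relMinors_ne_zero {n d : ℕ} [NeZero n] (hn : d + 1 ≤ n) : relMinors (d := d) hn ≠ 0 := by
  intro h
  let z : Fin n × Fin d → ℂ := fun v => if v.1.val = v.2.val + 1 then 1 else 0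
  have h1 := aeval_relMinors hn z
  have h2 : relMatrix hn (fun i k => z (i, k)) = 1 := by
    ext k j
    simp [relMatrix, z, one_apply, Fin.ext_iff, eq_comm]
  rw [h, h2, gramMinors_one, map_zero] at h1
  exact zero_ne_one h1

theorem aeval_ne_zero_of_algebraicIndependent {Ω σ : Type*} [Field Ω] [Algebra ℂ Ω] {γ : σ → Ω}
    (hγ : AlgebraicIndependent ℂ γ) {f : MvPolynomial σ ℂ} (z : σ → ℂ)
    (hz : MvPolynomial.aeval z f ≠ 0) : MvPolynomial.aeval γ f ≠ 0 := by
  intro h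
  rw [hγ.eq_zero_of_aeval_eq_zero f h, map_zero] at hz
  exact hz rfl

/-- The matrix of variables, with rows and columns indexed by the entries of the variable. -/
def varMatrix (d : ℕ) : Matrix (Fin d) (Fin d) (MvPolynomial (Fin d × Fin d) ℂ) :=
  of fun l k => MvPolynomial.X (l, k)

theorem varMatrix_map {S : Type*} [CommRing S] [Algebra ℂ S] {d : ℕ} (z : Fin d × Fin d → S) :
    (varMatrix d).map (MvPolynomial.aeval (R := ℂ) z).toRingHom = of fun l k => z (l, k) := by
  ext i j
  simp [varMatrix]

theorem aeval_gramMinors_varMatrix {S : Type*} [CommRing S] [Algebra ℂ S] {d : ℕ}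
    (z : Fin d × Fin d → S) : MvPolynomial.aeval z (gramMinors (varMatrix d)ᵀ) =
      gramMinors (of fun l k => z (l, k))ᵀ := by
  rw [← AlgHom.coe_toRingHom, map_gramMinors, transpose_map, ← varMatrix_map]
  rfl

theorem gramMinors_generic {Ω : Type*} [Field Ω] [Algebra ℂ Ω] {d : ℕ} {γ : Fin d × Fin d → Ω}
    (hγ : AlgebraicIndependent ℂ γ) : gramMinors (of fun l k => γ (l, k))ᵀ ≠ 0 := by
  rw [← aeval_gramMinors_varMatrix]
  refine aeval_ne_zero_of_algebraicIndependent hγ (fun v => (1 : Matrix _ _ ℂ) v.1 v.2) ?_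
  rw [aeval_gramMinors_varMatrix,
    show (of fun l k => (1 : Matrix (Fin d) (Fin d) ℂ) l k) = 1 from rfl, transpose_one,
    gramMinors_one]
  exact one_ne_zero

theorem adjugate_generic_ne_zero {Ω : Type*} [Field Ω] [Algebra ℂ Ω] {d : ℕ} {γ : Fin d × Fin d → Ω}
    (hγ : AlgebraicIndependent ℂ γ) (i j : Fin d) : (of fun l k => γ (l, k)).adjugate i j ≠ 0 := by
  rw [← varMatrix_map γ, ← RingHom.mapMatrix_apply, ← RingHom.map_adjugate]
  let M : Matrix (Fin d) (Fin d) ℂ := (Equiv.swap i j).permMatrix ℂ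
  refine aeval_ne_zero_of_algebraicIndependent hγ (fun v => M v.1 v.2) ?_
  have h : MvPolynomial.aeval (fun v : Fin d × Fin d => M v.1 v.2) ((varMatrix d).adjugate i j) =
      M.adjugate i j := by
    have := RingHom.map_adjugate
      (MvPolynomial.aeval (R := ℂ) fun v : Fin d × Fin d => M v.1 v.2).toRingHom
      (varMatrix d)
    rw [RingHom.mapMatrix_apply, RingHom.mapMatrix_apply, varMatrix_map] at this
    exact congrFun (congrFun this i) j
  have hM : M.updateRow j (Pi.single i 1) = M := by
    have : M j = Pi.single i 1 := by
      ext k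
      simp [M, Equiv.Perm.permMatrix, PEquiv.toMatrix_apply, Pi.single_apply, eq_comm]
    rw [← this, updateRow_eq_self]
  rw [h, adjugate_apply, hM, det_permutation]
  simp

end Minors

section
open MvPolynomial

section FibreMinors

theorem aeval_sqLen_eq_iff {Ω : Type*} [Field Ω] [Algebra ℂ Ω] {n d : ℕ} {G : SimpleGraph (Fin n)}
    (p q : Fin n × Fin d → Ω) :
    (∀ e : G.edgeSet,
        aeval q (sqLen ℂ d (e : Sym2 (Fin n))) = aeval p (sqLen ℂ d (e : Sym2 (Fin n)))) ↔
      (fun i k => q (i, k)) ∈ lengthFibre G fun i k => p (i, k) := by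
  have h : ∀ (z : Fin n × Fin d → Ω) (i j : Fin n),
      aeval z (sqLen ℂ d s(i, j)) = ∑ k, (z (i, k) - z (j, k)) ^ 2 := fun z i j =>
    aeval_sqLen_mk (R := ℂ) (fun i k => z (i, k)) i j
  constructor
  · intro H i j hij
    rw [← h, ← h]
    exact H ⟨s(i, j), hij⟩
  · rintro H ⟨e, he⟩
    induction e using Sym2.ind with
    | _ i j =>
      rw [h, h]
      exact H i j he

theorem gramMinors_ne_zero_of_mem_lengthFibre {Ω : Type*} [Field Ω] [IsAlgClosed Ω] [Algebra ℂ Ω]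
    {n d : ℕ} [NeZero n] (hn : d + 1 ≤ n) {G : SimpleGraph (Fin n)} {P : Type*}
    [Algebra (RatFuncField (G.edgeSet ⊕ P)) Ω] [IsScalarTower ℂ (RatFuncField (G.edgeSet ⊕ P)) Ω]
    {x : Fin n × Fin d → Ω} (hx : AlgebraicIndependent ℂ x)
    (hparam : ∀ e : G.edgeSet, algebraMap (RatFuncField (G.edgeSet ⊕ P)) Ω (ratParam (Sum.inl e)) =
      aeval x (sqLen ℂ d (e : Sym2 (Fin n))))
    (hfin : (Quotient.mk (congSetoid Ω n d) '' lengthFibre G fun i k => x (i, k)).Finite)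
    {q : Fin n → Fin d → Ω} (hq : q ∈ lengthFibre G fun i k => x (i, k)) :
    gramMinors (relMatrix hn q) ≠ 0 := by
  let S := paramSystem (P := P) (fun e : G.edgeSet => sqLen ℂ d (e : Sym2 (Fin n))) ∅
  have hzero : ∀ η : Fin n × Fin d → Ω, η ∈ zeroSet Ω S ↔
      (fun i k => η (i, k)) ∈ lengthFibre G fun i k => x (i, k) := by
    intro η
    rw [← aeval_sqLen_eq_iff]
    simp only [S, zeroSet, paramSystem, Set.image_empty, Set.union_empty, Set.mem_ofPred_eq,
      Set.forall_mem_range]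
    refine forall_congr' fun e => ?_
    rw [map_sub, aeval_map_algebraMap, aeval_C, hparam, sub_eq_zero]
  let b : MvPolynomial (Fin n × Fin d) (RatFuncField (G.edgeSet ⊕ P)) :=
    map (algebraMap ℂ (RatFuncField (G.edgeSet ⊕ P))) (relMinors hn)
  have hb : ∀ η : Fin n × Fin d → Ω,
      aeval η b = gramMinors (relMatrix hn fun i k => η (i, k)) := fun η => by
    rw [aeval_map_algebraMap, aeval_relMinors]
  have hxS : x ∈ zeroSet Ω S := (hzero x).mpr fun _ _ _ => rfl
  have hbS : b ∉ Ideal.span S := fun hmem => by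
    have h0 : Ideal.span S ≤ RingHom.ker (aeval x) := Ideal.span_le.mpr hxS
    have h1 : aeval x b = 0 := h0 hmem
    rw [aeval_map_algebraMap] at h1
    exact relMinors_ne_zero hn (hx.eq_zero_of_aeval_eq_zero _ h1)
  have hqS : (fun v : Fin n × Fin d => q v.1 v.2) ∈ zeroSet Ω S := (hzero _).mpr hq
  have := aeval_ne_zero_of_finite_values (paramSystem_prime _ ∅ x hxS).1 b hbS ?_ hqS
  · rwa [hb] at this
  · let g : Quotient (congSetoid Ω n d) → Ω :=
      Quotient.lift (fun q => gramMinors (relMatrix hn q)) fun _ _ h =>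
      gramMinors_relMatrix_congr hn h
    refine (hfin.image g).subset ?_
    rintro _ ⟨η, hη, rfl⟩
    exact ⟨_, ⟨_, (hzero η).mp hη, rfl⟩, (hb η).symm⟩

end FibreMinors

section Pinned
open Matrix

theorem ncard_eq_mul_of_fibres {α β : Type*} (f : α → β) {S : Set α} {T : Set β} (hT : T.Finite)
    (hf : Set.MapsTo f S T) {m : ℕ} (hm : 0 < m) (h : ∀ b ∈ T, {a ∈ S | f a = b}.ncard = m) :
    S.Finite ∧ S.ncard = T.ncard * m := by
  classical
  have hS : S.Finite := by
    refine (hT.biUnion fun b hb => Set.finite_of_ncard_pos (h b hb ▸ hm)).subset fun a ha => ?_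
    exact Set.mem_biUnion (hf ha) ⟨ha, rfl⟩
  refine ⟨hS, ?_⟩
  lift S to Finset α using hS
  lift T to Finset β using hT
  rw [Set.ncard_coe_finset, Set.ncard_coe_finset, Finset.card_eq_sum_card_fiberwise hf,
    Finset.sum_const_nat]
  intro b hb
  rw [← h b hb, ← Set.ncard_coe_finset, Finset.coe_filter]
  rfl

/-- The realisations with the same edge lengths as `p`, with the vertex `0` at the origin and the
next vertices pinned to flags prescribed by the rows of `Γ`. -/
def pinnedFibre {F : Type*} [Field F] {n d : ℕ} [NeZero n] (hn : d + 1 ≤ n)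
    (G : SimpleGraph (Fin n))
    (Γ : Matrix (Fin d) (Fin d) F) (p : Fin n → Fin d → F) : Set (Fin n → Fin d → F) :=
  {q ∈ lengthFibre G p | q 0 = 0 ∧
    ∀ l j : Fin d, l.val + j.val + 1 < d → (Γ * relMatrix hn q) l j = 0}

theorem mem_lengthFibre_of_cong {F : Type*} [Field F] {n d : ℕ} {G : SimpleGraph (Fin n)}
    {p q r : Fin n → Fin d → F} (h : congSetoid F n d q r) (hr : r ∈ lengthFibre G p) :
    q ∈ lengthFibre G p := by
  obtain ⟨A, x, hA, h⟩ := h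
  intro i j hij
  rw [← hr i j hij]
  refine Eq.trans ?_ (sum_sq_mulVec hA (r i - r j))
  refine Finset.sum_congr rfl fun k _ => ?_
  congr 1
  rw [h i, h j, mulVec_sub]
  simp

theorem ncard_pinnedFibre {F : Type*} [Field F] [CharZero F] [IsAlgClosed F] {n d : ℕ} [NeZero n]
    (hn : d + 1 ≤ n) (G : SimpleGraph (Fin n)) (Γ : Matrix (Fin d) (Fin d) F)
    (p : Fin n → Fin d → F) (hΓ : gramMinors Γᵀ ≠ 0)
    (hp : ∀ q ∈ lengthFibre G p, gramMinors (relMatrix hn q) ≠ 0)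
    (hfin : (Quotient.mk (congSetoid F n d) '' lengthFibre G p).Finite) :
    (pinnedFibre hn G Γ p).Finite ∧ (pinnedFibre hn G Γ p).ncard =
      (Quotient.mk (congSetoid F n d) '' lengthFibre G p).ncard * 2 ^ d := by
  refine ncard_eq_mul_of_fibres (Quotient.mk _) hfin (fun q hq => ⟨q, hq.1, rfl⟩) (by positivity) ?_
  rintro _ ⟨r, hr, rfl⟩
  have hU := hp r hr
  have hΓ' := det_ne_zero_of_gramMinors hΓ
  rw [transpose_transpose] at hΓ'
  rw [← ncard_pinnedOrthogonal Γ (relMatrix hn r) hΓ' (det_ne_zero_of_gramMinors hU)]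
  let place : Matrix (Fin d) (Fin d) F → Fin n → Fin d → F := fun A i => A *ᵥ r i + -(A *ᵥ r 0)
  have hrel : ∀ A, relMatrix hn (place A) = A * relMatrix hn r := fun A =>
    relMatrix_mulVec_add hn r A _
  have hinj : Function.Injective place := by
    intro A B hAB
    have h1 := hrel A
    rw [hAB, hrel B] at h1
    have hu := isUnit_det_of_gramMinors hU
    calc A = A * relMatrix hn r * (relMatrix hn r)⁻¹ := by
          rw [Matrix.mul_assoc, mul_nonsing_inv _ hu, Matrix.mul_one]
      _ = B := by rw [← h1, Matrix.mul_assoc, mul_nonsing_inv _ hu, Matrix.mul_one]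
  rw [← Set.ncard_image_of_injective _ hinj]
  congr 1
  ext q
  constructor
  · rintro ⟨⟨hq, hq0, hpin⟩, hqr⟩
    obtain ⟨A, y, hA, h⟩ : congSetoid F n d q r := Quotient.exact hqr
    have hy : y = -(A *ᵥ r 0) := by
      rw [eq_neg_iff_add_eq_zero, add_comm, ← h 0, hq0]
    have hqA : place A = q := by
      ext1 i
      rw [h i, hy]
    refine ⟨A, ⟨hA, fun l j hlj => ?_⟩, hqA⟩
    rw [Matrix.mul_assoc, ← hrel, hqA]
    exact hpin l j hlj
  · rintro ⟨A, ⟨hA, hpin⟩, rfl⟩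
    have hc : congSetoid F n d (place A) r := ⟨A, _, hA, fun _ => rfl⟩
    refine ⟨⟨mem_lengthFibre_of_cong hc hr, add_neg_cancel _, fun l j hlj => ?_⟩, Quotient.sound hc⟩
    rw [hrel, ← Matrix.mul_assoc]
    exact hpin l j hlj

end Pinned

end

section EdgeVariables
open MvPolynomial Matrix
variable {n d : ℕ} {G : SimpleGraph (Fin n)}

/-- The value on an oriented edge of a vector assigned to the edges oriented increasingly. -/
def dartValue {S : Type*} [CommRing S] (ξ : G.edgeSet × Fin d → S) (a : G.Dart) (k : Fin d) : S :=
  if a.fst < a.snd then ξ (⟨a.edge, a.edge_mem⟩, k) else -ξ (⟨a.edge, a.edge_mem⟩, k)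

theorem dartValue_symm {S : Type*} [CommRing S] (ξ : G.edgeSet × Fin d → S) (a : G.Dart)
    (k : Fin d) : dartValue ξ a.symm k = -dartValue ξ a k := by
  have h := a.adj.ne
  have he : (⟨a.symm.edge, a.symm.edge_mem⟩ : G.edgeSet) = ⟨a.edge, a.edge_mem⟩ :=
    Subtype.ext a.edge_symm
  have h1 : a.symm.fst = a.snd := rfl
  have h2 : a.symm.snd = a.fst := rfl
  rw [dartValue, dartValue, he, h1, h2]
  rcases h.lt_or_gt with h | h
  · rw [if_pos h, if_neg h.not_gt]
  · rw [if_pos h, if_neg h.not_gt, neg_neg]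

/-- The edge vectors of a realisation, edges being oriented increasingly. -/
def edgeVec {S : Type*} [CommRing S] (G : SimpleGraph (Fin n)) (q : Fin n → Fin d → S) :
    G.edgeSet × Fin d → S :=
  fun v => q (v.1 : Sym2 (Fin n)).inf v.2 - q (v.1 : Sym2 (Fin n)).sup v.2

theorem dartValue_edgeVec {S : Type*} [CommRing S] (q : Fin n → Fin d → S) (a : G.Dart)
    (k : Fin d) : dartValue (edgeVec G q) a k = q a.fst k - q a.snd k := by
  obtain ⟨⟨i, j⟩, hij⟩ := a
  let a : G.Dart := ⟨(i, j), hij⟩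
  have h1 : ∀ k, edgeVec G q (⟨a.edge, a.edge_mem⟩, k) = q (i ⊓ j) k - q (i ⊔ j) k := fun _ => rfl
  rw [dartValue, h1]
  rcases (G.ne_of_adj hij).lt_or_gt with h | h
  · rw [if_pos h, inf_of_le_left h.le, sup_of_le_right h.le]
  · rw [if_neg h.not_gt, inf_of_le_right h.le, sup_of_le_left h.le, neg_sub]

/-- Every edge underlies an increasingly oriented dart. -/
theorem exists_dart_edge (e : G.edgeSet) :
    ∃ a : G.Dart, a.fst < a.snd ∧ (⟨a.edge, a.edge_mem⟩ : G.edgeSet) = e := by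
  obtain ⟨e, he⟩ := e
  induction e using Sym2.ind with
  | _ i j =>
    rcases (G.ne_of_adj he).lt_or_gt with h | h
    · exact ⟨⟨(i, j), he⟩, h, rfl⟩
    · exact ⟨⟨(j, i), G.adj_symm he⟩, h, Subtype.ext Sym2.eq_swap⟩

theorem dartValue_injective {S : Type*} [CommRing S] {ξ ζ : G.edgeSet × Fin d → S}
    (h : ∀ a k, dartValue ξ a k = dartValue ζ a k) : ξ = ζ := by
  ext1 ⟨e, k⟩
  obtain ⟨a, ha, rfl⟩ := exists_dart_edge e
  have := h a k
  rwa [dartValue, dartValue, if_pos ha, if_pos ha] at this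

/-- The sum of the squares of the coordinates of an edge. -/
def sqSum (d : ℕ) {E : Type*} (e : E) : MvPolynomial (E × Fin d) ℂ := ∑ k, X (e, k) ^ 2

theorem sum_sq_edgeVec {F : Type*} [CommRing F] [Algebra ℂ F] (x : Fin n × Fin d → F)
    (e : G.edgeSet) :
    ∑ k, edgeVec G (fun i k => x (i, k)) (e, k) ^ 2 = aeval x (sqLen ℂ d (e : Sym2 (Fin n))) := by
  obtain ⟨a, ha, rfl⟩ := exists_dart_edge e
  have h1 : ∀ k, edgeVec G (fun i k => x (i, k)) (⟨a.edge, a.edge_mem⟩, k) =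
      x (a.fst, k) - x (a.snd, k) := fun k => by
    have := dartValue_edgeVec (fun i k => x (i, k)) a k
    rwa [dartValue, if_pos ha] at this
  simp only [h1]
  exact (aeval_sqLen_mk (R := ℂ) (fun i k => x (i, k)) a.fst a.snd).symm

section Pairing
variable {V R S : Type*} [Fintype V] [CommRing R] [CommRing S]

/-- The pairing of linear forms over `R` with vectors over `S` along `τ : R →+* S`. -/
def pairing (τ : R →+* S) (ξ : V → S) : (V → R) →+ S where
  toFun w := ∑ u, τ (w u) * ξ u
  map_zero' := by simp
  map_add' w z := by simp [add_mul, Finset.sum_add_distrib]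

theorem pairing_apply (τ : R →+* S) (ξ : V → S) (w : V → R) :
    pairing τ ξ w = ∑ u, τ (w u) * ξ u := rfl

theorem pairing_smul (τ : R →+* S) (ξ : V → S) (r : R) (w : V → R) :
    pairing τ ξ (r • w) = τ r * pairing τ ξ w := by
  simp [pairing_apply, Finset.mul_sum, mul_assoc]

end Pairing

variable {R S : Type*} [CommRing R] [CommRing S] [Fintype (G.edgeSet × Fin d)]

open Classical in
/-- The coordinate vector of the signed edge variable of a dart. -/
def dartCoeff (R : Type*) [CommRing R] (a : G.Dart) (k : Fin d) : G.edgeSet × Fin d → R :=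
  if a.fst < a.snd then Pi.single (⟨a.edge, a.edge_mem⟩, k) 1
  else -Pi.single (⟨a.edge, a.edge_mem⟩, k) 1

theorem pairing_dartCoeff (τ : R →+* S) (ξ : G.edgeSet × Fin d → S) (a : G.Dart) (k : Fin d) :
    pairing τ ξ (dartCoeff R a k) = dartValue ξ a k := by
  classical
  have h : ∀ v, pairing τ ξ (Pi.single v 1) = ξ v := fun v => by
    rw [pairing_apply, Finset.sum_eq_single v]
    · simp
    · intro u _ hu
      simp [Pi.single_eq_of_ne hu]
    · simp
  rw [dartCoeff, dartValue]
  split_ifs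
  · convert h _
  · rw [map_neg]
    congr 1
    convert h _

/-- The pinning form of the vertex `i` and the `l`-th parametric hyperplane. -/
def pinForm {m : ℕ} {i j : Fin n} (hij : G.Adj i j) (l : Fin m) :
    G.edgeSet × Fin d → MvPolynomial (Fin m × Fin d) ℂ :=
  ∑ k, (X (l, k) : MvPolynomial (Fin m × Fin d) ℂ) •
    dartCoeff (MvPolynomial (Fin m × Fin d) ℂ) (⟨(i, j), hij⟩ : G.Dart) k

/-- The `k`-th coordinate of the edge sum along a walk. -/
def walkForm (R : Type*) [CommRing R] {u v : Fin n} (w : G.Walk u v) (k : Fin d) :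
    G.edgeSet × Fin d → R :=
  (w.darts.map fun a => dartCoeff R a k).sum

theorem pairing_pinForm {m : ℕ} (τ : MvPolynomial (Fin m × Fin d) ℂ →+* S)
    (ξ : G.edgeSet × Fin d → S) {i j : Fin n} (hij : G.Adj i j) (l : Fin m) :
    pairing τ ξ (pinForm hij l) =
      ∑ k, τ (X (l, k)) * dartValue ξ (⟨(i, j), hij⟩ : G.Dart) k := by
  simp only [pinForm, map_sum, pairing_smul, pairing_dartCoeff]

theorem pairing_walkForm (τ : R →+* S) (ξ : G.edgeSet × Fin d → S) {u v : Fin n} (w : G.Walk u v)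
    (k : Fin d) : pairing τ ξ (walkForm R w k) = walkSum (fun a => dartValue ξ a k) w := by
  rw [walkForm, map_list_sum, List.map_map, walkSum]
  congr 2
  ext1 a
  exact pairing_dartCoeff τ ξ a k

variable [NeZero n]

/-- The linear equations of the edge-variable system: pinning forms and cycle forms. -/
def edgeForms (G : SimpleGraph (Fin n)) (d : ℕ) :
    Set (G.edgeSet × Fin d → MvPolynomial (Fin (d - 1) × Fin d) ℂ) :=
  {w | ∃ (i : Fin n) (hadj : G.Adj 0 i) (l : Fin (d - 1)),
    0 < i.val ∧ i.val < d ∧ l.val < d - i.val ∧ w = pinForm hadj l} ∪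
  {w | ∃ (v : Fin n) (p : G.Walk v v), p.IsCycle ∧ ∃ k, w = walkForm _ p k}

theorem forall_edgeForms_pairing (τ : MvPolynomial (Fin (d - 1) × Fin d) ℂ →+* S)
    (ξ : G.edgeSet × Fin d → S) :
    (∀ w ∈ edgeForms G d, ∑ u, τ (w u) * ξ u = 0) ↔
      (∀ (i : Fin n) (hadj : G.Adj 0 i) (l : Fin (d - 1)), 0 < i.val → i.val < d →
        l.val < d - i.val → ∑ k, τ (X (l, k)) * dartValue ξ (⟨(0, i), hadj⟩ : G.Dart) k = 0) ∧
      ∀ (v : Fin n) (p : G.Walk v v), p.IsCycle → ∀ k : Fin d,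
        walkSum (fun a => dartValue ξ a k) p = 0 := by
  simp only [← pairing_apply τ ξ]
  constructor
  · refine fun h => ⟨fun i hadj l h1 h2 h3 => ?_, fun v p hp k => ?_⟩
    · rw [← pairing_pinForm]
      exact h _ (Or.inl ⟨i, hadj, l, h1, h2, h3, rfl⟩)
    · rw [← pairing_walkForm τ]
      exact h _ (Or.inr ⟨v, p, hp, k, rfl⟩)
  · rintro ⟨hpin, hcyc⟩ w (⟨i, hadj, l, h1, h2, h3, rfl⟩ | ⟨v, p, hp, k, rfl⟩)
    · rw [pairing_pinForm]
      exact hpin i hadj l h1 h2 h3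
    · rw [pairing_walkForm]
      exact hcyc v p hp k

end EdgeVariables

section EdgeSystem
open MvPolynomial Matrix
variable {n d : ℕ} {G : SimpleGraph (Fin n)}

theorem walkSum_edgeVec {S : Type*} [CommRing S] (q : Fin n → Fin d → S) {u v : Fin n}
    (p : G.Walk u v) (k : Fin d) :
    walkSum (fun a => dartValue (edgeVec G q) a k) p = q u k - q v k := by
  simp only [dartValue_edgeVec]
  exact walkSum_sub (fun i => q i k) p

variable [NeZero n]

theorem toLaurent_linForm {E P V : Type*} [Fintype V] (w : V → MvPolynomial P ℂ) :
    toLaurent (RatFuncField (E ⊕ P)) V (linForm fun v => paramIncl E P (w v)) =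
      pairing ((algebraMap _ (LaurentRing (RatFuncField (E ⊕ P)) V)).comp (paramIncl E P))
        LX w := by
  rw [linForm_apply, map_sum, pairing_apply]
  refine Finset.sum_congr rfl fun v _ => ?_
  rw [map_mul, toLaurent, aeval_C, aeval_X]
  rfl

theorem paramIncl_X (E : Type*) {P : Type*} (c : P) :
    paramIncl E P (X c) = ratParam (Sum.inr c) := by
  simp [paramIncl, ratParam]

theorem toLaurent_image_paramSystem [Fintype (G.edgeSet × Fin d)] :
    toLaurent (RatFuncField (↥G.edgeSet ⊕ Fin (d - 1) × Fin d)) (↥G.edgeSet × Fin d) ''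
      paramSystem (sqSum d) (edgeForms G d) =
      {g : LaurentRing (RatFuncField (↥G.edgeSet ⊕ Fin (d - 1) × Fin d))
              (↥G.edgeSet × Fin d) |
            ∃ e : ↥G.edgeSet,
              g = (∑ k : Fin d, (LX (e, k)) ^ 2) -
                algebraMap _ _ (ratParam (P := ↥G.edgeSet ⊕ Fin (d - 1) × Fin d) (Sum.inl e))} ∪
          {g : LaurentRing (RatFuncField (↥G.edgeSet ⊕ Fin (d - 1) × Fin d))
              (↥G.edgeSet × Fin d) |
            ∃ (i : Fin n) (hadj : G.Adj 0 i) (l : Fin (d - 1)),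
              0 < i.val ∧ i.val < d ∧ l.val < d - i.val ∧
              g = ∑ k : Fin d,
                algebraMap _ _ (ratParam (P := ↥G.edgeSet ⊕ Fin (d - 1) × Fin d) (Sum.inr (l, k))) *
                  ydir (RatFuncField (↥G.edgeSet ⊕ Fin (d - 1) × Fin d))
                    (⟨(0, i), hadj⟩ : G.Dart) k} ∪
          {g : LaurentRing (RatFuncField (↥G.edgeSet ⊕ Fin (d - 1) × Fin d))
              (↥G.edgeSet × Fin d) |
            ∃ (v : Fin n) (w : G.Walk v v), w.IsCycle ∧ ∃ k : Fin d,
              g = (w.darts.map fun dd =>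
                ydir (RatFuncField (↥G.edgeSet ⊕ Fin (d - 1) × Fin d)) dd k).sum} := by
  rw [paramSystem, Set.image_union, ← Set.range_comp, Set.image_image, edgeForms, Set.image_union,
    ← Set.union_assoc]
  congr 1
  · congr 1
    · ext g
      refine exists_congr fun e => ?_
      rw [eq_comm]
      simp only [Function.comp_apply, map_sub, sqSum, map_sum, map_pow, map_X, toLaurent, aeval_X,
        aeval_C]
    · ext g
      constructor
      · rintro ⟨_, ⟨i, hadj, l, h1, h2, h3, rfl⟩, rfl⟩
        refine ⟨i, hadj, l, h1, h2, h3, ?_⟩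
        refine (toLaurent_linForm _).trans ?_
        rw [pairing_pinForm]
        simp only [RingHom.comp_apply, paramIncl_X]
        rfl
      · rintro ⟨i, hadj, l, h1, h2, h3, rfl⟩
        refine ⟨_, ⟨i, hadj, l, h1, h2, h3, rfl⟩, ?_⟩
        refine (toLaurent_linForm _).trans ?_
        rw [pairing_pinForm]
        simp only [RingHom.comp_apply, paramIncl_X]
        rfl
  · ext g
    constructor
    · rintro ⟨_, ⟨v, p, hp, k, rfl⟩, rfl⟩
      refine ⟨v, p, hp, k, ?_⟩
      exact (toLaurent_linForm _).trans (pairing_walkForm _ _ _ _)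
    · rintro ⟨v, p, hp, k, rfl⟩
      refine ⟨_, ⟨v, p, hp, k, rfl⟩, ?_⟩
      exact (toLaurent_linForm _).trans (pairing_walkForm _ _ _ _)

theorem exists_edgeVec_eq {S : Type*} [CommRing S] (hG : G.Preconnected)
    (ξ : G.edgeSet × Fin d → S)
    (hcyc : ∀ (v : Fin n) (p : G.Walk v v), p.IsCycle → ∀ k,
      walkSum (fun a => dartValue ξ a k) p = 0) :
    ∃ q : Fin n → Fin d → S, q 0 = 0 ∧ edgeVec G q = ξ := by
  choose q hq0 hq using fun k : Fin d => exists_potential hG 0 (fun a => dartValue ξ a k)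
    (fun a => dartValue_symm ξ a k) fun v p hp => hcyc v p hp k
  refine ⟨fun i k => q k i, funext hq0, dartValue_injective fun a k => ?_⟩
  rw [dartValue_edgeVec, hq]

theorem edgeVec_injOn {S : Type*} [CommRing S] (hG : G.Preconnected) :
    Set.InjOn (edgeVec (S := S) (d := d) G) {q | q 0 = 0} := by
  intro q hq r hr h
  ext i k
  obtain ⟨p⟩ := hG i 0
  have h1 := walkSum_edgeVec q p k
  rw [h, walkSum_edgeVec r p k, hq, hr] at h1
  simpa using h1.symm

variable {Ω : Type*} [Field Ω] [Algebra ℂ Ω]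

theorem exists_edgeForms_solution [Fintype (G.edgeSet × Fin d)]
    {γ : Fin d × Fin d → Ω} (hγ : AlgebraicIndependent ℂ γ)
    (τ : MvPolynomial (Fin (d - 1) × Fin d) ℂ →+* Ω)
    (hτ : ∀ c, τ (X c) = γ (Fin.castLE (Nat.sub_le d 1) c.1, c.2)) (v : G.edgeSet × Fin d) :
    ∃ ξ : G.edgeSet × Fin d → Ω, (∀ w ∈ edgeForms G d, ∑ u, τ (w u) * ξ u = 0) ∧ ξ v ≠ 0 := by
  obtain ⟨e, k⟩ := v
  obtain ⟨a, ha, rfl⟩ := exists_dart_edge e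
  let last : Fin d := ⟨d - 1, by have := k.isLt; omega⟩
  let Γ : Matrix (Fin d) (Fin d) Ω := of fun l k => γ (l, k)
  let z : Fin d → Ω := fun k => Γ.adjugate k last
  let q : Fin n → Fin d → Ω := fun i => if i = a.snd then z else 0
  have hz : ∀ l : Fin (d - 1), ∑ k, γ (Fin.castLE (Nat.sub_le d 1) l, k) * z k = 0 := fun l => by
    have h1 := congrFun (congrFun Γ.mul_adjugate (Fin.castLE (Nat.sub_le d 1) l)) last
    have hne : Fin.castLE (Nat.sub_le d 1) l ≠ last := by
      simp only [last, ne_eq, Fin.ext_iff, Fin.val_castLE]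
      omega
    rw [mul_apply, Matrix.smul_apply, one_apply_ne hne, smul_zero] at h1
    exact h1
  refine ⟨edgeVec G q, (forall_edgeForms_pairing τ _).mpr ⟨?_, ?_⟩, ?_⟩
  · intro i hadj l _ _ _
    have h1 : ∀ j : Fin n, ∑ k, γ (Fin.castLE (Nat.sub_le d 1) l, k) * q j k = 0 := fun j => by
      simp only [q]
      split_ifs
      · exact hz l
      · simp
    simp only [hτ, dartValue_edgeVec, mul_sub, Finset.sum_sub_distrib, h1, sub_self]
  · intro v p _ k
    rw [walkSum_edgeVec, sub_self]
  · have h1 := dartValue_edgeVec (G := G) q a k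
    rw [dartValue, if_pos ha] at h1
    rw [h1]
    simp only [q, if_neg ha.ne, if_true, Pi.zero_apply, zero_sub, ne_eq, neg_eq_zero]
    exact adjugate_generic_ne_zero hγ k last

variable [Algebra (RatFuncField (G.edgeSet ⊕ Fin (d - 1) × Fin d)) Ω]
  [IsScalarTower ℂ (RatFuncField (G.edgeSet ⊕ Fin (d - 1) × Fin d)) Ω]

theorem zeroSet_edgeSystem [Fintype (G.edgeSet × Fin d)] (hn : d + 1 ≤ n)
    (hlab : ∀ i : Fin n, 0 < i.val → i.val < d → G.Adj 0 i) (hG : G.Preconnected)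
    {x : Fin n × Fin d → Ω} {γ : Fin d × Fin d → Ω}
    (hx : ∀ e : G.edgeSet, algebraMap (RatFuncField (G.edgeSet ⊕ Fin (d - 1) × Fin d)) Ω
      (ratParam (Sum.inl e)) = aeval x (sqLen ℂ d (e : Sym2 (Fin n))))
    (hγ : ∀ c : Fin (d - 1) × Fin d,
      algebraMap (RatFuncField (G.edgeSet ⊕ Fin (d - 1) × Fin d)) Ω (ratParam (Sum.inr c)) =
        γ (Fin.castLE (Nat.sub_le d 1) c.1, c.2)) :
    zeroSet Ω (paramSystem (sqSum d) (edgeForms G d)) =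
      edgeVec G '' pinnedFibre hn G (of fun l k => γ (l, k)) fun i k => x (i, k) := by
  let τ : MvPolynomial (Fin (d - 1) × Fin d) ℂ →+* Ω :=
    (algebraMap (RatFuncField (G.edgeSet ⊕ Fin (d - 1) × Fin d)) Ω).comp (paramIncl _ _)
  have hτ : ∀ c, τ (X c) = γ (Fin.castLE (Nat.sub_le d 1) c.1, c.2) := fun c => by
    rw [RingHom.comp_apply, paramIncl_X, hγ]
  have hmem : ∀ η : G.edgeSet × Fin d → Ω, η ∈ zeroSet Ω (paramSystem (sqSum d) (edgeForms G d)) ↔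
      (∀ e : G.edgeSet, ∑ k, η (e, k) ^ 2 = aeval x (sqLen ℂ d (e : Sym2 (Fin n)))) ∧
      ∀ w ∈ edgeForms G d, ∑ u, τ (w u) * η u = 0 := by
    intro η
    simp only [zeroSet, paramSystem, Set.mem_ofPred_eq, Set.mem_union, or_imp, forall_and,
      Set.forall_mem_range, Set.forall_mem_image]
    refine and_congr (forall_congr' fun e => ?_) (forall₂_congr fun w _ => ?_)
    · rw [map_sub, aeval_map_algebraMap, aeval_C, hx, sub_eq_zero]
      simp [sqSum]
    · simp only [linForm_apply, map_sum, map_mul, aeval_C, aeval_X]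
      rfl
  have hpin : ∀ q : Fin n → Fin d → Ω, q 0 = 0 →
      ((∀ (i : Fin n) (hadj : G.Adj 0 i) (l : Fin (d - 1)), 0 < i.val → i.val < d →
        l.val < d - i.val →
          ∑ k, τ (X (l, k)) * dartValue (edgeVec G q) (⟨(0, i), hadj⟩ : G.Dart) k = 0) ↔
      ∀ l j : Fin d, l.val + j.val + 1 < d →
        ((of fun l k => γ (l, k) : Matrix (Fin d) (Fin d) Ω) * relMatrix hn q) l j = 0) := by
    intro q hq
    have hsum : ∀ (i : Fin n) (hadj : G.Adj 0 i) (l : Fin (d - 1)),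
        ∑ k, τ (X (l, k)) * dartValue (edgeVec G q) (⟨(0, i), hadj⟩ : G.Dart) k =
          -∑ k, γ (Fin.castLE (Nat.sub_le d 1) l, k) * (q i k - q 0 k) := fun i hadj l => by
      rw [← Finset.sum_neg_distrib]
      refine Finset.sum_congr rfl fun k _ => ?_
      rw [hτ, dartValue_edgeVec]
      ring
    constructor
    · intro h l j hlj
      have hi : (Fin.castLE hn j.succ).val = j.val + 1 := rfl
      have := h (Fin.castLE hn j.succ) (hlab _ (by omega) (by omega)) ⟨l, by omega⟩ (by omega)
        (by omega) (by simp only [hi]; omega)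
      rw [hsum, neg_eq_zero] at this
      rw [mul_apply]
      exact this
    · intro h i hadj l h1 h2 h3
      have := h (Fin.castLE (Nat.sub_le d 1) l) ⟨i - 1, by omega⟩ (by simp; omega)
      rw [mul_apply] at this
      rw [hsum, neg_eq_zero, ← this]
      refine Finset.sum_congr rfl fun k _ => ?_
      have hi : i = Fin.castLE hn (Fin.succ ⟨i - 1, by omega⟩) := by
        ext
        simp
        omega
      conv_lhs => rw [hi]
      rfl
  ext η
  rw [hmem, forall_edgeForms_pairing]
  constructor
  · rintro ⟨hlen, hp, hcyc⟩
    obtain ⟨q, hq0, rfl⟩ := exists_edgeVec_eq hG η hcyc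
    refine ⟨q, ⟨?_, hq0, (hpin q hq0).mp hp⟩, rfl⟩
    refine (aeval_sqLen_eq_iff x fun v => q v.1 v.2).mp fun e => ?_
    rw [← hlen, ← sum_sq_edgeVec]
  · rintro ⟨q, ⟨hlen, hq0, hp⟩, rfl⟩
    refine ⟨fun e => ?_, (hpin q hq0).mpr hp, fun v p _ k => ?_⟩
    · rw [← (aeval_sqLen_eq_iff x fun v => q v.1 v.2).mpr hlen e, ← sum_sq_edgeVec]
    · rw [walkSum_edgeVec, sub_self]

end EdgeSystem

/-- For a minimally `d`-rigid graph `G` labelled so that vertex `1` is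
adjacent to vertices `2, …, d`, the generic root count of the edge-variable system `I_E`
(edge-length polynomials, vertex-pinning polynomials, and cycle polynomials) equals
`2^d · c_d(G)`. -/
theorem statement_12 {n d : ℕ} [NeZero n] (hd : 1 ≤ d) (hn : d + 1 ≤ n)
    (G : SimpleGraph (Fin n))
    (hlab : ∀ i : Fin n, 0 < i.val → i.val < d → G.Adj 0 i)
    (hG : IsMinimallyRigidGraph G d)
    (c : ℕ) (hc : IsRealisationNumber G d c) :
    Module.finrank (RatFuncField (↥G.edgeSet ⊕ Fin (d - 1) × Fin d))
      (LaurentRing (RatFuncField (↥G.edgeSet ⊕ Fin (d - 1) × Fin d))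
          (↥G.edgeSet × Fin d) ⧸
        Ideal.span (
          {g : LaurentRing (RatFuncField (↥G.edgeSet ⊕ Fin (d - 1) × Fin d))
              (↥G.edgeSet × Fin d) |
            ∃ e : ↥G.edgeSet,
              g = (∑ k : Fin d, (LX (e, k)) ^ 2) -
                algebraMap _ _ (ratParam (P := ↥G.edgeSet ⊕ Fin (d - 1) × Fin d) (Sum.inl e))} ∪
          {g : LaurentRing (RatFuncField (↥G.edgeSet ⊕ Fin (d - 1) × Fin d))
              (↥G.edgeSet × Fin d) |
            ∃ (i : Fin n) (hadj : G.Adj 0 i) (l : Fin (d - 1)),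
              0 < i.val ∧ i.val < d ∧ l.val < d - i.val ∧
              g = ∑ k : Fin d,
                algebraMap _ _ (ratParam (P := ↥G.edgeSet ⊕ Fin (d - 1) × Fin d) (Sum.inr (l, k))) *
                  ydir (RatFuncField (↥G.edgeSet ⊕ Fin (d - 1) × Fin d))
                    (⟨(0, i), hadj⟩ : G.Dart) k} ∪
          {g : LaurentRing (RatFuncField (↥G.edgeSet ⊕ Fin (d - 1) × Fin d))
              (↥G.edgeSet × Fin d) |
            ∃ (v : Fin n) (w : G.Walk v v), w.IsCycle ∧ ∃ k : Fin d,
              g = (w.darts.map fun dd =>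
                ydir (RatFuncField (↥G.edgeSet ⊕ Fin (d - 1) × Fin d)) dd k).sum})) =
      2 ^ d * c := by
  have : Fintype (G.edgeSet × Fin d) := Fintype.ofFinite _
  let ι : Fin (d - 1) × Fin d → Fin d × Fin d := fun c => (Fin.castLE (Nat.sub_le d 1) c.1, c.2)
  have hι : Function.Injective ι :=
    Function.Injective.prodMap (Fin.castLE_injective _) Function.injective_id
  obtain ⟨Ω, _, _, _, _, _, x, γ, ⟨e⟩, hind, hlen, hpar⟩ := exists_generic_point hG hι
  have : CharZero Ω := charZero_of_injective_algebraMap (algebraMap ℂ Ω).injective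
  have hx : AlgebraicIndependent ℂ x := hind.comp Sum.inl Sum.inl_injective
  have hγ : AlgebraicIndependent ℂ γ := hind.comp Sum.inr Sum.inr_injective
  have hconn := hG.1.preconnected hd
  have hcard := ncard_classes_generic e hc hx
  have hfin := Set.finite_of_ncard_pos (hcard ▸ hc.1)
  obtain ⟨hpfin, hpcard⟩ := ncard_pinnedFibre hn G (Matrix.of fun l k => γ (l, k))
    (fun i k => x (i, k)) (gramMinors_generic hγ)
    (fun q hq => gramMinors_ne_zero_of_mem_lengthFibre hn hx hlen hfin hq) hfin
  have hzero := zeroSet_edgeSystem hn hlab hconn hlen hpar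
  have hzcard : (zeroSet Ω (paramSystem (sqSum d) (edgeForms G d))).ncard = 2 ^ d * c := by
    rw [hzero, Set.InjOn.ncard_image ((edgeVec_injOn hconn).mono fun q hq => hq.2.1), hpcard,
      hcard, mul_comm]
  rw [← hzcard, ← finrank_laurent_paramSystem (sqSum d) (edgeForms G d) (hzero ▸ hpfin.image _)
    (Set.nonempty_of_ncard_ne_zero ?_) ?_, toLaurent_image_paramSystem]
  · rw [hzcard]
    exact (Nat.mul_pos (by positivity) hc.1).ne'
  · refine exists_edgeForms_solution hγ
      ((algebraMap (RatFuncField (G.edgeSet ⊕ Fin (d - 1) × Fin d)) Ω).comp (paramIncl _ _))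
      fun c => ?_
    rw [RingHom.comp_apply, paramIncl_X]
    exact hpar c

end PaperDefs
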